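/- arXiv:1012.4414 — 2 statements merged into one kernel-verified Lean document; each statement's English description precedes it below -/
import Mathlib

section
/- Let k ≥ 1 and n ≥ 2k+1 be integers. If u : ℝⁿ∖{0} → ℝ is smooth, positively homogeneous of degree 0, and satisfies Δ₀ᵏ u = 0 on ℝⁿ∖{0}, then u is constant. -/
open MeasureTheory Real

/-- The geometric Laplacian `Δ₀ f = -∑ ∂²f/∂xᵢ²` on Euclidean space. -/
noncomputable def lap {n : ℕ} (f : EuclideanSpace ℝ (Fin n) → ℝ) :
    EuclideanSpace ℝ (Fin n) → ℝ :=
  fun x => - ∑ i : Fin n,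
    fderiv ℝ (fun y => fderiv ℝ f y (EuclideanSpace.single i 1)) x (EuclideanSpace.single i 1)

/-- The `k`-fold iterate `Δ₀ᵏ` of the geometric Laplacian. -/
noncomputable def lapIter {n : ℕ} (k : ℕ) :
    (EuclideanSpace ℝ (Fin n) → ℝ) → (EuclideanSpace ℝ (Fin n) → ℝ) :=
  lap^[k]

open scoped ContDiff Topology

section Euclidean

variable {n : ℕ}

/-- The `i`-th partial derivative of a function on Euclidean space. -/
noncomputable def partialDeriv (i : Fin n) (f : EuclideanSpace ℝ (Fin n) → ℝ) :
    EuclideanSpace ℝ (Fin n) → ℝ :=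
  fun x => fderiv ℝ f x (EuclideanSpace.single i 1)

/-- `f` is positively homogeneous of degree `-m` away from the origin. -/
def HomogeneousNeg (m : ℕ) (f : EuclideanSpace ℝ (Fin n) → ℝ) : Prop :=
  ∀ t : ℝ, 0 < t → ∀ x : EuclideanSpace ℝ (Fin n), x ≠ 0 → t ^ m * f (t • x) = f x

/-- `f` is smooth away from the origin. -/
def SmoothOffZero (f : EuclideanSpace ℝ (Fin n) → ℝ) : Prop :=
  ContDiffOn ℝ ∞ f {(0 : EuclideanSpace ℝ (Fin n))}ᶜ

lemma lap_eq_neg_sum_partialDeriv (f : EuclideanSpace ℝ (Fin n) → ℝ)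
    (x : EuclideanSpace ℝ (Fin n)) :
    lap f x = -∑ i, partialDeriv i (partialDeriv i f) x := rfl

lemma SmoothOffZero.contDiffAt {f : EuclideanSpace ℝ (Fin n) → ℝ} (hf : SmoothOffZero f)
    {x : EuclideanSpace ℝ (Fin n)} (hx : x ≠ 0) : ContDiffAt ℝ ∞ f x :=
  ContDiffOn.contDiffAt hf (isOpen_compl_singleton.mem_nhds hx)

lemma SmoothOffZero.differentiableAt {f : EuclideanSpace ℝ (Fin n) → ℝ} (hf : SmoothOffZero f)
    {x : EuclideanSpace ℝ (Fin n)} (hx : x ≠ 0) : DifferentiableAt ℝ f x :=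
  (hf.contDiffAt hx).differentiableAt (by simp)

lemma SmoothOffZero.partialDeriv {f : EuclideanSpace ℝ (Fin n) → ℝ} (hf : SmoothOffZero f)
    (i : Fin n) : SmoothOffZero (partialDeriv i f) :=
  (hf.fderiv_of_isOpen isOpen_compl_singleton (by simp)).clm_apply contDiffOn_const

lemma SmoothOffZero.lap {f : EuclideanSpace ℝ (Fin n) → ℝ} (hf : SmoothOffZero f) :
    SmoothOffZero (lap f) :=
  (ContDiffOn.sum fun i _ => (hf.partialDeriv i).partialDeriv i).neg

lemma HomogeneousNeg.partialDeriv {m : ℕ} {f : EuclideanSpace ℝ (Fin n) → ℝ}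
    (hf : SmoothOffZero f) (hom : HomogeneousNeg m f) (i : Fin n) :
    HomogeneousNeg (m + 1) (partialDeriv i f) := by
  intro t ht x hx
  have htx : t • x ≠ 0 := smul_ne_zero ht.ne' hx
  have heq : (fun y => t ^ m * f (t • y)) =ᶠ[𝓝 x] f := by
    filter_upwards [isOpen_compl_singleton.mem_nhds hx] with y hy using hom t ht y hy
  have hd : DifferentiableAt ℝ (fun y => f (t • y)) x :=
    (hf.differentiableAt htx).comp x (differentiableAt_id.const_smul t)
  have h := heq.fderiv_eq (𝕜 := ℝ)
  rw [fderiv_const_mul hd, fderiv_comp_smul] at h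
  simp only [_root_.partialDeriv, ← h, _root_.smul_apply, smul_eq_mul]
  ring

lemma HomogeneousNeg.lap {m : ℕ} {f : EuclideanSpace ℝ (Fin n) → ℝ}
    (hf : SmoothOffZero f) (hom : HomogeneousNeg m f) : HomogeneousNeg (m + 2) (lap f) := by
  intro t ht x hx
  simp only [lap_eq_neg_sum_partialDeriv, mul_neg, Finset.mul_sum]
  congr 1
  exact Finset.sum_congr rfl fun i _ =>
    (hom.partialDeriv hf i).partialDeriv (hf.partialDeriv i) i t ht x hx

/-- A continuous linear functional is determined by its values on the standard basis. -/
lemma sum_mul_apply_single (L : EuclideanSpace ℝ (Fin n) →L[ℝ] ℝ)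
    (x : EuclideanSpace ℝ (Fin n)) :
    ∑ i, x i * L (EuclideanSpace.single i 1) = L x := by
  conv_rhs => rw [← (EuclideanSpace.basisFun (Fin n) ℝ).sum_repr x]
  simp [map_sum]

/-- The Euler identity for homogeneous functions. -/
lemma HomogeneousNeg.sum_mul_partialDeriv {m : ℕ} {f : EuclideanSpace ℝ (Fin n) → ℝ}
    (hf : SmoothOffZero f) (hom : HomogeneousNeg m f) {x : EuclideanSpace ℝ (Fin n)}
    (hx : x ≠ 0) : ∑ i, x i * _root_.partialDeriv i f x = -(m * f x) := by
  have hfx : HasFDerivAt f (fderiv ℝ f x) ((1 : ℝ) • x) := by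
    simpa using (hf.differentiableAt hx).hasFDerivAt
  have hline : HasDerivAt (fun t : ℝ => t • x) x 1 := by
    simpa using (hasDerivAt_id (1 : ℝ)).smul_const x
  have h := (hasDerivAt_pow m (1 : ℝ)).mul (hfx.comp_hasDerivAt (1 : ℝ) hline)
  have hconst : (fun t : ℝ => t ^ m * f (t • x)) =ᶠ[𝓝 1] fun _ => f x := by
    filter_upwards [lt_mem_nhds one_pos] with t ht using hom t ht x hx
  have h0 := h.unique ((hasDerivAt_const (1 : ℝ) (f x)).congr_of_eventuallyEq hconst)
  have hsum := sum_mul_apply_single (fderiv ℝ f x) x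
  simp only [Function.comp_apply, one_pow, mul_one, one_smul, one_mul] at h0
  simp only [_root_.partialDeriv, hsum]
  linarith

lemma integral_partialDeriv_eq_zero {g : EuclideanSpace ℝ (Fin n) → ℝ} (hg : ContDiff ℝ 1 g)
    (hc : HasCompactSupport g) (i : Fin n) :
    Integrable (partialDeriv i g) ∧ ∫ x, partialDeriv i g x = 0 := by
  have hcont : Continuous (partialDeriv i g) :=
    (hg.continuous_fderiv one_ne_zero).clm_apply continuous_const
  have hint : Integrable (partialDeriv i g) :=
    hcont.integrable_of_hasCompactSupport (hc.fderiv_apply ℝ _)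
  refine ⟨hint, ?_⟩
  have h := integral_mul_fderiv_eq_neg_fderiv_mul_of_integrable (𝕜 := ℝ)
    (μ := (volume : Measure (EuclideanSpace ℝ (Fin n)))) (f := fun _ => (1 : ℝ)) (g := g)
    (v := EuclideanSpace.single i 1) (by simp)
    (by simpa only [one_mul] using! hint)
    (by simpa using hg.continuous.integrable_of_hasCompactSupport hc)
    (fun _ _ => differentiableAt_const _) (fun x _ => hg.differentiable one_ne_zero x)
  simpa [partialDeriv] using h

/-- A vector field tangent to spheres about the origin whose divergence is nonnegative is
divergence free. -/
lemma sum_partialDeriv_eq_zero_of_tangential {F : Fin n → EuclideanSpace ℝ (Fin n) → ℝ}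
    (hF : ∀ i, SmoothOffZero (F i))
    (htan : ∀ x : EuclideanSpace ℝ (Fin n), x ≠ 0 → ∑ i, x i * F i x = 0)
    (hdiv : ∀ x : EuclideanSpace ℝ (Fin n), x ≠ 0 → 0 ≤ ∑ i, partialDeriv i (F i) x)
    {x : EuclideanSpace ℝ (Fin n)} (hx : x ≠ 0) : ∑ i, partialDeriv i (F i) x = 0 := by
  have hr : 0 < ‖x‖ ^ 2 := by positivity
  let θ : ContDiffBump (‖x‖ ^ 2) := ⟨‖x‖ ^ 2 / 4, ‖x‖ ^ 2 / 2, by positivity, by linarith⟩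
  let φ : EuclideanSpace ℝ (Fin n) → ℝ := fun y => θ (‖y‖ ^ 2)
  have hφ : ContDiff ℝ ∞ φ := θ.contDiff.comp (contDiff_norm_sq ℝ)
  have hφ0 : φ =ᶠ[𝓝 0] 0 := by
    have hcont : Continuous fun y : EuclideanSpace ℝ (Fin n) => ‖y‖ ^ 2 := by fun_prop
    have hmem : ∀ᶠ y : EuclideanSpace ℝ (Fin n) in 𝓝 0, ‖y‖ ^ 2 < ‖x‖ ^ 2 / 2 :=
      hcont.continuousAt.eventually_lt continuousAt_const (by simpa using hr)
    filter_upwards [hmem] with y hy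
    refine θ.zero_of_le_dist ?_
    change ‖x‖ ^ 2 / 2 ≤ dist (‖y‖ ^ 2) (‖x‖ ^ 2)
    rw [Real.dist_eq, abs_sub_comm]
    exact le_trans (by linarith) (le_abs_self _)
  have hφc : HasCompactSupport φ := by
    refine HasCompactSupport.of_support_subset_isCompact
      (isCompact_closedBall (0 : EuclideanSpace ℝ (Fin n)) (2 * ‖x‖)) fun y hy => ?_
    by_contra hlt
    have hlt' : 2 * ‖x‖ < ‖y‖ := by simpa using hlt
    refine hy (θ.zero_of_le_dist ?_)
    change ‖x‖ ^ 2 / 2 ≤ dist (‖y‖ ^ 2) (‖x‖ ^ 2)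
    rw [Real.dist_eq]
    refine le_trans ?_ (le_abs_self _)
    nlinarith [norm_nonneg x]
  have hG : ∀ i, ContDiff ℝ 1 fun y => φ y * F i y := by
    intro i
    rw [contDiff_iff_contDiffAt]
    intro y
    rcases eq_or_ne y 0 with rfl | hy
    · refine (contDiffAt_const (c := (0 : ℝ))).congr_of_eventuallyEq ?_
      filter_upwards [hφ0] with y hy
      simp [hy]
    · exact (hφ.contDiffAt.mul ((hF i).contDiffAt hy)).of_le (by simp)
  have hGc : ∀ i, HasCompactSupport fun y => φ y * F i y := fun i => hφc.mul_right
  have hG0 : ∀ i, partialDeriv i (fun y => φ y * F i y) 0 = 0 := by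
    intro i
    have : (fun y => φ y * F i y) =ᶠ[𝓝 0] fun _ => 0 := by
      filter_upwards [hφ0] with y hy
      simp [hy]
    simp [partialDeriv, this.fderiv_eq]
  have hφd : ∀ i y, partialDeriv i φ y = deriv θ (‖y‖ ^ 2) * 2 * y i := by
    intro i y
    have hθ : HasDerivAt θ (deriv θ (‖y‖ ^ 2)) (‖y‖ ^ 2) :=
      (θ.contDiff.differentiable (n := 1) one_ne_zero _).hasDerivAt
    have h := hθ.comp_hasFDerivAt y (hasStrictFDerivAt_norm_sq y).hasFDerivAt
    have h' : fderiv ℝ φ y = _ := h.fderiv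
    simp [partialDeriv, h', EuclideanSpace.inner_single_right]
    ring
  have hGd : ∀ y, y ≠ 0 → ∑ i, partialDeriv i (fun y => φ y * F i y) y
      = φ y * ∑ i, partialDeriv i (F i) y := by
    intro y hy
    have hterm : ∀ i, partialDeriv i (fun y => φ y * F i y) y
        = φ y * partialDeriv i (F i) y + deriv θ (‖y‖ ^ 2) * 2 * (y i * F i y) := by
      intro i
      have hd := hφd i y
      simp only [partialDeriv] at hd ⊢
      rw [fderiv_fun_mul (hφ.differentiable (by simp) y) ((hF i).differentiableAt hy)]
      simp only [_root_.add_apply, _root_.smul_apply, smul_eq_mul, hd]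
      ring
    simp only [hterm, Finset.sum_add_distrib, ← Finset.mul_sum, htan y hy, mul_zero, add_zero]
  have hcont : Continuous fun y => ∑ i, partialDeriv i (fun y => φ y * F i y) y :=
    continuous_finsetSum _ fun i _ =>
      ((hG i).continuous_fderiv one_ne_zero).clm_apply continuous_const
  have hnonneg : ∀ y, 0 ≤ ∑ i, partialDeriv i (fun y => φ y * F i y) y := by
    intro y
    rcases eq_or_ne y 0 with rfl | hy
    · simp [hG0]
    · rw [hGd y hy]
      exact mul_nonneg θ.nonneg (hdiv y hy)
  have hint : ∫ y, ∑ i, partialDeriv i (fun y => φ y * F i y) y = 0 := by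
    rw [integral_finsetSum _ fun i _ => (integral_partialDeriv_eq_zero (hG i) (hGc i) i).1]
    exact Finset.sum_eq_zero fun i _ => (integral_partialDeriv_eq_zero (hG i) (hGc i) i).2
  have hae := (integral_eq_zero_iff_of_nonneg hnonneg
    (integrable_finsetSum _ fun i _ => (integral_partialDeriv_eq_zero (hG i) (hGc i) i).1)).1 hint
  have hzero := congrFun ((hcont.ae_eq_iff_eq volume continuous_const).1 hae) x
  have hφx : φ x = 1 := θ.one_of_mem_closedBall (by simp [θ.rIn_pos.le])
  rw [hGd x hx, hφx, one_mul] at hzero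
  exact hzero

/-- A harmonic function which is homogeneous of degree `-m` with `m + 2 ≤ n` satisfies both
extremal identities for the field `‖x‖² f ∇f + m f² x`. -/
lemma HomogeneousNeg.extremal_identities_of_lap_eq_zero {m : ℕ} (hm : m + 2 ≤ n)
    {f : EuclideanSpace ℝ (Fin n) → ℝ} (hf : SmoothOffZero f) (hom : HomogeneousNeg m f)
    (hlap : ∀ x : EuclideanSpace ℝ (Fin n), x ≠ 0 → _root_.lap f x = 0)
    {x : EuclideanSpace ℝ (Fin n)} (hx : x ≠ 0) :
    m * ((n : ℝ) - 2 - m) * f x ^ 2 = 0 ∧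
      ‖x‖ ^ 2 * ∑ i, _root_.partialDeriv i f x ^ 2 = m ^ 2 * f x ^ 2 := by
  let F : Fin n → EuclideanSpace ℝ (Fin n) → ℝ := fun i y =>
    ‖y‖ ^ 2 * (f y * _root_.partialDeriv i f y) + m * (f y ^ 2 * y i)
  have hcoord : ∀ i : Fin n, ContDiff ℝ ∞ fun y : EuclideanSpace ℝ (Fin n) => y i :=
    fun i => (EuclideanSpace.proj i : EuclideanSpace ℝ (Fin n) →L[ℝ] ℝ).contDiff
  have hF : ∀ i, SmoothOffZero (F i) := fun i =>
    ((contDiff_norm_sq ℝ).contDiffOn.mul (ContDiffOn.mul hf (hf.partialDeriv i))).add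
      (contDiffOn_const.mul ((ContDiffOn.pow hf 2).mul (hcoord i).contDiffOn))
  have hnorm : ∀ y : EuclideanSpace ℝ (Fin n), ∑ i, y i * y i = ‖y‖ ^ 2 := by
    intro y
    simp [EuclideanSpace.norm_sq_eq, ← sq]
  have htan : ∀ y : EuclideanSpace ℝ (Fin n), y ≠ 0 → ∑ i, y i * F i y = 0 := by
    intro y hy
    have hsum : ∑ i, y i * F i y = ‖y‖ ^ 2 * f y * ∑ i, y i * _root_.partialDeriv i f y
        + m * f y ^ 2 * ∑ i, y i * y i := by
      simp only [Finset.mul_sum, ← Finset.sum_add_distrib, F]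
      exact Finset.sum_congr rfl fun i _ => by ring
    rw [hsum, hom.sum_mul_partialDeriv hf hy, hnorm]
    ring
  have hdiv : ∀ y : EuclideanSpace ℝ (Fin n), y ≠ 0 → ∑ i, _root_.partialDeriv i (F i) y
      = (‖y‖ ^ 2 * ∑ i, _root_.partialDeriv i f y ^ 2 - m ^ 2 * f y ^ 2)
        + m * ((n : ℝ) - 2 - m) * f y ^ 2 := by
    intro y hy
    have hterm : ∀ i, _root_.partialDeriv i (F i) y =
        (2 + 2 * m) * f y * (y i * _root_.partialDeriv i f y)
        + ‖y‖ ^ 2 * _root_.partialDeriv i f y ^ 2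
        + ‖y‖ ^ 2 * f y * _root_.partialDeriv i (_root_.partialDeriv i f) y
        + m * f y ^ 2 := by
      intro i
      have h1 := (hf.differentiableAt hy).hasFDerivAt
      have h2 := ((hf.partialDeriv i).differentiableAt hy).hasFDerivAt
      have h3 := (EuclideanSpace.proj i : EuclideanSpace ℝ (Fin n) →L[ℝ] ℝ).hasFDerivAt (x := y)
      have h4 := (hasStrictFDerivAt_norm_sq y).hasFDerivAt
      have h := (h4.mul (h1.mul h2)).add (((h1.pow 2).mul h3).const_mul (m : ℝ))
      have h' : fderiv ℝ (F i) y = _ := h.fderiv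
      rw [_root_.partialDeriv, h']
      simp [EuclideanSpace.inner_single_right]
      simp only [_root_.partialDeriv]
      ring
    have hl : ∑ i, _root_.partialDeriv i (_root_.partialDeriv i f) y = 0 :=
      neg_eq_zero.1 (hlap y hy)
    simp only [hterm, Finset.sum_add_distrib, ← Finset.mul_sum, hl,
      hom.sum_mul_partialDeriv hf hy]
    simp
    ring
  have hcs : ∀ y : EuclideanSpace ℝ (Fin n), y ≠ 0 →
      0 ≤ ‖y‖ ^ 2 * ∑ i, _root_.partialDeriv i f y ^ 2 - m ^ 2 * f y ^ 2 := by
    intro y hy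
    have h := Finset.sum_mul_sq_le_sq_mul_sq Finset.univ (fun i => y i)
      fun i => _root_.partialDeriv i f y
    rw [hom.sum_mul_partialDeriv hf hy] at h
    simp only [← hnorm, ← sq] at h ⊢
    linarith
  have hcoef : ∀ y : EuclideanSpace ℝ (Fin n), 0 ≤ m * ((n : ℝ) - 2 - m) * f y ^ 2 := by
    intro y
    have : (m : ℝ) + 2 ≤ n := by exact_mod_cast hm
    exact mul_nonneg (mul_nonneg m.cast_nonneg (by linarith)) (sq_nonneg _)
  have hzero := sum_partialDeriv_eq_zero_of_tangential hF htan
    (fun y hy => by rw [hdiv y hy]; exact add_nonneg (hcs y hy) (hcoef y)) hx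
  rw [hdiv x hx] at hzero
  have h1 := hcs x hx
  have h2 := hcoef x
  constructor <;> linarith

lemma SmoothOffZero.lapIter {f : EuclideanSpace ℝ (Fin n) → ℝ} (hf : SmoothOffZero f) (k : ℕ) :
    SmoothOffZero (lapIter k f) := by
  induction k with
  | zero => exact hf
  | succ k ih =>
    rw [_root_.lapIter, Function.iterate_succ_apply']
    exact ih.lap

lemma HomogeneousNeg.lapIter {f : EuclideanSpace ℝ (Fin n) → ℝ} (hf : SmoothOffZero f)
    (hom : HomogeneousNeg 0 f) (k : ℕ) : HomogeneousNeg (2 * k) (lapIter k f) := by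
  induction k with
  | zero => exact hom
  | succ k ih =>
    rw [_root_.lapIter, Function.iterate_succ_apply']
    exact ih.lap (hf.lapIter k)

/-- A polyharmonic function of low order which is homogeneous of degree zero is harmonic. -/
lemma HomogeneousNeg.lap_eq_zero_of_lapIter_eq_zero {f : EuclideanSpace ℝ (Fin n) → ℝ}
    (hf : SmoothOffZero f) (hom : HomogeneousNeg 0 f) {k : ℕ} (hk : 1 ≤ k) (hn : 2 * k + 1 ≤ n)
    (hlap : ∀ x : EuclideanSpace ℝ (Fin n), x ≠ 0 → _root_.lapIter k f x = 0) :
    ∀ x : EuclideanSpace ℝ (Fin n), x ≠ 0 → _root_.lap f x = 0 := by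
  induction k, hk using Nat.le_induction with
  | base => exact hlap
  | succ k hk ih =>
    refine ih (by omega) fun x hx => ?_
    have h := ((hom.lapIter hf k).extremal_identities_of_lap_eq_zero (by omega) (hf.lapIter k)
      (fun y hy => by
        have := hlap y hy
        rwa [_root_.lapIter, Function.iterate_succ_apply'] at this) hx).1
    have hk' : (0 : ℝ) < k := by exact_mod_cast hk
    have hn' : 2 * ((k : ℝ) + 1) + 1 ≤ n := by exact_mod_cast hn
    push_cast at h
    have hpos : 0 < 2 * (k : ℝ) * ((n : ℝ) - 2 - 2 * k) :=
      mul_pos (by linarith) (by linarith)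
    simpa [hpos.ne'] using h

end Euclidean

theorem homogeneous_polyharmonic_of_degree_zero_is_constant
    (n k : ℕ) (hk : 1 ≤ k) (hn : 2 * k + 1 ≤ n)
    (u : EuclideanSpace ℝ (Fin n) → ℝ)
    (hsmooth : ContDiffOn ℝ (⊤ : ℕ∞) u {(0 : EuclideanSpace ℝ (Fin n))}ᶜ)
    (hhom : ∀ t : ℝ, 0 < t → ∀ x : EuclideanSpace ℝ (Fin n), x ≠ 0 →
      u (t • x) = u x)
    (hharm : ∀ x : EuclideanSpace ℝ (Fin n), x ≠ 0 → lapIter k u x = 0) :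
    ∃ c : ℝ, ∀ x : EuclideanSpace ℝ (Fin n), x ≠ 0 → u x = c := by
  have hu : SmoothOffZero u := hsmooth
  have hom : HomogeneousNeg 0 u := fun t ht x hx => by simpa using hhom t ht x hx
  have hlap := hom.lap_eq_zero_of_lapIter_eq_zero hu hk hn hharm
  have hconn : IsConnected ({0}ᶜ : Set (EuclideanSpace ℝ (Fin n))) :=
    isConnected_compl_singleton_of_one_lt_rank
      (Module.lt_rank_of_lt_finrank (by simpa using (by omega : 1 < n))) 0
  refine isOpen_compl_singleton.exists_is_const_of_fderiv_eq_zero (𝕜 := ℝ) hconn.isPreconnected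
    (fun x hx => (hu.differentiableAt hx).differentiableWithinAt) fun x hx => ?_
  have hgrad := (hom.extremal_identities_of_lap_eq_zero (by omega) hu hlap hx).2
  have hx' : x ≠ 0 := hx
  have hsum : ∑ i, partialDeriv i u x ^ 2 = 0 := by simpa [hx'] using hgrad
  rw [Finset.sum_eq_zero_iff_of_nonneg fun i _ => sq_nonneg _] at hsum
  ext v
  rw [← sum_mul_apply_single (fderiv ℝ u x) v]
  refine Finset.sum_eq_zero fun i hi => ?_
  have hi' : fderiv ℝ u x (EuclideanSpace.single i 1) = 0 := pow_eq_zero_iff two_ne_zero |>.1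
    (hsum i hi)
  rw [hi', mul_zero]
end

section
/- Let n ≥ 2 and k ≥ 1 be integers and let α ∈ ℝ be a real number that is not an integer. For every smooth function f : ℝⁿ∖{0} → ℝ that is positively homogeneous of degree α−2k, there exists a unique smooth function u : ℝⁿ∖{0} → ℝ that is positively homogeneous of degree α and satisfies Δ₀ᵏ u = f on ℝⁿ∖{0}. (That is, Δ₀ᵏ is bijective from smooth functions positively homogeneous of degree α to smooth functions positively homogeneous of degree α−2k.) -/
open MeasureTheory Real

open Filter Topology Set Metric
open scoped ContDiff

section Homogeneous

variable {E V : Type*} [NormedAddCommGroup E] [NormedSpace ℝ E]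
  [NormedAddCommGroup V] [NormedSpace ℝ V]

/-- `u` is smooth and positively homogeneous of degree `a` away from the origin. -/
structure SmoothHom (a : ℝ) (u : E → V) : Prop where
  smooth : ContDiffOn ℝ ∞ u {0}ᶜ
  hom : ∀ t : ℝ, 0 < t → ∀ x : E, x ≠ 0 → u (t • x) = t ^ a • u x

namespace SmoothHom

variable {a b : ℝ} {u v : E → V}

theorem contDiffAt (hu : SmoothHom a u) {x : E} (hx : x ≠ 0) : ContDiffAt ℝ ∞ u x :=
  hu.smooth.contDiffAt (isOpen_compl_singleton.mem_nhds hx)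

theorem differentiableAt (hu : SmoothHom a u) {x : E} (hx : x ≠ 0) : DifferentiableAt ℝ u x :=
  (hu.contDiffAt hx).differentiableAt (by simp)

theorem continuousOn (hu : SmoothHom a u) : ContinuousOn u {0}ᶜ := hu.smooth.continuousOn

theorem congr (hu : SmoothHom a u) (h : ∀ x ≠ 0, v x = u x) : SmoothHom a v where
  smooth := hu.smooth.congr fun x hx => h x hx
  hom t ht x hx := by
    rw [h _ (smul_ne_zero ht.ne' hx), h x hx, hu.hom t ht x hx]

theorem sub (hu : SmoothHom a u) (hv : SmoothHom a v) : SmoothHom a (fun x => u x - v x) where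
  smooth := hu.smooth.sub hv.smooth
  hom t ht x hx := by simp only [hu.hom t ht x hx, hv.hom t ht x hx, smul_sub]

theorem sum {ι : Type*} (s : Finset ι) {w : ι → E → V} (hw : ∀ i, SmoothHom a (w i)) :
    SmoothHom a (fun x => ∑ i ∈ s, w i x) where
  smooth := ContDiffOn.sum fun i _ => (hw i).smooth
  hom t ht x hx := by simp only [fun i => (hw i).hom t ht x hx, Finset.smul_sum]

theorem mul {p q : E → ℝ} (hp : SmoothHom a p) (hq : SmoothHom b q) :
    SmoothHom (a + b) (fun x => p x * q x) where
  smooth := hp.smooth.mul hq.smooth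
  hom t ht x hx := by
    simp only [hp.hom t ht x hx, hq.hom t ht x hx, smul_eq_mul, rpow_add ht]; ring

theorem const_mul {p : E → ℝ} (c : ℝ) (hp : SmoothHom a p) :
    SmoothHom a (fun x => c * p x) where
  smooth := contDiffOn_const.mul hp.smooth
  hom t ht x hx := by simp only [hp.hom t ht x hx, smul_eq_mul]; ring

protected theorem fderiv (hu : SmoothHom a u) : SmoothHom (a - 1) (fderiv ℝ u) where
  smooth := hu.smooth.fderiv_of_isOpen isOpen_compl_singleton (by simp)
  hom t ht x hx := by
    have h1 : (fun y => u (t • y)) =ᶠ[𝓝 x] fun y => t ^ a • u y := by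
      filter_upwards [isOpen_compl_singleton.mem_nhds hx] with y hy using hu.hom t ht y hy
    have h2 := h1.fderiv_eq (𝕜 := ℝ)
    rw [fderiv_comp_smul, fderiv_fun_const_smul (hu.differentiableAt hx)] at h2
    rw [rpow_sub_one ht.ne', div_eq_inv_mul, mul_smul, ← h2, smul_smul, inv_mul_cancel₀ ht.ne',
      one_smul]

theorem fderiv_apply (hu : SmoothHom a u) (e : E) :
    SmoothHom (a - 1) (fun x => fderiv ℝ u x e) where
  smooth := hu.fderiv.smooth.clm_apply contDiffOn_const
  hom t ht x hx := by rw [hu.fderiv.hom t ht x hx]; rfl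

/-- Euler's identity. -/
theorem fderiv_self (hu : SmoothHom a u) {x : E} (hx : x ≠ 0) : fderiv ℝ u x x = a • u x := by
  have hd : HasDerivAt (fun t : ℝ => t • x) x 1 := by
    simpa using (hasDerivAt_id (1 : ℝ)).smul_const x
  have h1 : HasDerivAt (fun t : ℝ => u (t • x)) (fderiv ℝ u x x) 1 := by
    have hu' : HasFDerivAt u (fderiv ℝ u x) ((1 : ℝ) • x) := by
      rw [one_smul]; exact (hu.differentiableAt hx).hasFDerivAt
    exact hu'.comp_hasDerivAt (1 : ℝ) hd
  have h2 : HasDerivAt (fun t : ℝ => t ^ a • u x) (a • u x) 1 := by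
    simpa using (hasDerivAt_rpow_const (x := 1) (p := a) (by simp)).smul_const (u x)
  refine h1.unique (h2.congr_of_eventuallyEq ?_)
  filter_upwards [lt_mem_nhds (show (0 : ℝ) < 1 by norm_num)] with t ht using hu.hom t ht x hx

theorem exists_norm_le [FiniteDimensional ℝ E] (hu : SmoothHom a u) :
    ∃ C, 0 ≤ C ∧ ∀ x ≠ 0, ‖u x‖ ≤ C * ‖x‖ ^ a := by
  obtain ⟨C, hC⟩ := (isCompact_sphere (0 : E) 1).exists_bound_of_continuousOn
    (hu.continuousOn.mono fun x hx => by
      rintro rfl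
      simp at hx)
  refine ⟨max C 0, le_max_right _ _, fun x hx => ?_⟩
  have hx' : 0 < ‖x‖ := norm_pos_iff.2 hx
  have h1 := hu.hom ‖x‖ hx' (‖x‖⁻¹ • x) (smul_ne_zero (inv_ne_zero hx'.ne') hx)
  rw [smul_smul, mul_inv_cancel₀ hx'.ne', one_smul] at h1
  rw [h1, norm_smul, norm_of_nonneg (by positivity), mul_comm]
  gcongr
  refine (hC _ ?_).trans (le_max_left _ _)
  simp [norm_smul, hx'.ne']

theorem measurable [MeasurableSpace E] [BorelSpace E] [MeasurableSpace V] [BorelSpace V]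
    (hu : SmoothHom a u) : Measurable u :=
  measurable_of_continuousOn_compl_singleton 0 hu.continuousOn

/-- The product of a smooth function vanishing near the origin and a function smooth away from the
origin is smooth. -/
theorem contDiff_mul {χ p : E → ℝ} (hp : SmoothHom a p) (hχ : ContDiff ℝ ∞ χ)
    (h0 : (0 : E) ∉ tsupport χ) : ContDiff ℝ ∞ (fun x => χ x * p x) := by
  refine contDiff_iff_contDiffAt.2 fun x => ?_
  by_cases hx : x = 0
  · subst hx
    refine (contDiffAt_const (c := (0 : ℝ))).congr_of_eventuallyEq ?_
    filter_upwards [notMem_tsupport_iff_eventuallyEq.1 h0] with y hy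
    simp [hy]
  · exact hχ.contDiffAt.mul (hp.contDiffAt hx)

end SmoothHom

end Homogeneous

theorem smoothHom_norm_rpow {E : Type*} [NormedAddCommGroup E] [InnerProductSpace ℝ E] (s : ℝ) :
    SmoothHom s (fun x : E => ‖x‖ ^ s) where
  smooth := by
    intro x hx
    exact ((contDiffAt_norm ℝ hx).rpow_const_of_ne (norm_ne_zero_iff.2 hx)).contDiffWithinAt
  hom t ht x _ := by
    rw [norm_smul, norm_of_nonneg ht.le, mul_rpow ht.le (norm_nonneg x), smul_eq_mul]

section PartialDerivatives

variable {n : ℕ}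

/-- The `i`-th partial derivative. -/
noncomputable def pd (i : Fin n) (u : EuclideanSpace ℝ (Fin n) → ℝ)
    (x : EuclideanSpace ℝ (Fin n)) : ℝ :=
  fderiv ℝ u x (EuclideanSpace.single i 1)

variable {a b : ℝ} {i j : Fin n} {u v : EuclideanSpace ℝ (Fin n) → ℝ}
  {x : EuclideanSpace ℝ (Fin n)}

theorem lap_eq_neg_sum_pd : lap u x = -∑ i, pd i (pd i u) x := rfl

theorem pd_congr (h : ∀ y ≠ 0, u y = v y) (hx : x ≠ 0) : pd i u x = pd i v x := by
  have : u =ᶠ[𝓝 x] v := by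
    filter_upwards [isOpen_compl_singleton.mem_nhds hx] with y hy using h y hy
  rw [pd, pd, this.fderiv_eq]

theorem lap_congr (h : ∀ y ≠ 0, u y = v y) (hx : x ≠ 0) : lap u x = lap v x := by
  rw [lap_eq_neg_sum_pd, lap_eq_neg_sum_pd]
  congr 1
  exact Finset.sum_congr rfl fun i _ => pd_congr (fun y hy => pd_congr h hy) hx

theorem pd_add (hu : DifferentiableAt ℝ u x) (hv : DifferentiableAt ℝ v x) :
    pd i (fun y => u y + v y) x = pd i u x + pd i v x := by
  simp [pd, fderiv_fun_add hu hv]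

theorem pd_sub (hu : DifferentiableAt ℝ u x) (hv : DifferentiableAt ℝ v x) :
    pd i (fun y => u y - v y) x = pd i u x - pd i v x := by
  simp [pd, fderiv_fun_sub hu hv]

theorem pd_mul (hu : DifferentiableAt ℝ u x) (hv : DifferentiableAt ℝ v x) :
    pd i (fun y => u y * v y) x = u x * pd i v x + v x * pd i u x := by
  simp [pd, fderiv_fun_mul hu hv]

theorem pd_const_mul (c : ℝ) (hu : DifferentiableAt ℝ u x) :
    pd i (fun y => c * u y) x = c * pd i u x := by
  simp [pd, fderiv_const_mul hu]

theorem pd_sum {ι : Type*} {s : Finset ι} {w : ι → EuclideanSpace ℝ (Fin n) → ℝ}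
    (hw : ∀ k, DifferentiableAt ℝ (w k) x) :
    pd i (fun y => ∑ k ∈ s, w k y) x = ∑ k ∈ s, pd i (w k) x := by
  simp [pd, fderiv_fun_sum fun k _ => hw k]

theorem contDiff_coord (i : Fin n) :
    ContDiff ℝ ∞ (fun y : EuclideanSpace ℝ (Fin n) => y i) := by fun_prop

theorem pd_coord : pd i (fun y => y j) x = if i = j then 1 else 0 := by
  have : (fun y : EuclideanSpace ℝ (Fin n) => y j) = EuclideanSpace.proj (𝕜 := ℝ) j := rfl
  rw [pd, this, ContinuousLinearMap.fderiv]
  simp [eq_comm]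

theorem pd_norm_sq : pd i (fun y => ‖y‖ ^ 2) x = 2 * x i := by
  rw [pd, (hasStrictFDerivAt_norm_sq x).hasFDerivAt.fderiv]
  simp [EuclideanSpace.inner_single_right]

theorem pd_comp {g : ℝ → ℝ} (hg : DifferentiableAt ℝ g (u x)) (hu : DifferentiableAt ℝ u x) :
    pd i (fun y => g (u y)) x = deriv g (u x) * pd i u x := by
  have := (hg.hasDerivAt.comp_hasFDerivAt x hu.hasFDerivAt).fderiv
  rw [pd, pd]
  change fderiv ℝ (g ∘ u) x _ = _
  rw [this]; simp

theorem pd_norm_rpow (s : ℝ) (hx : x ≠ 0) :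
    pd i (fun y => ‖y‖ ^ s) x = s * (x i * ‖x‖ ^ (s - 2)) := by
  have h : (fun y : EuclideanSpace ℝ (Fin n) => ‖y‖ ^ s) = fun y => (‖y‖ ^ 2) ^ (s / 2) := by
    funext y
    rw [← rpow_natCast, ← rpow_mul (norm_nonneg y)]
    congr 1; push_cast; ring
  have hx' : ‖x‖ ^ 2 ≠ 0 := by simpa using hx
  rw [h, pd_comp (g := fun r => r ^ (s / 2)) (hasDerivAt_rpow_const (Or.inl hx')).differentiableAt
    (hasStrictFDerivAt_norm_sq x).differentiableAt, (hasDerivAt_rpow_const (Or.inl hx')).deriv,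
    pd_norm_sq, ← rpow_natCast,
    ← rpow_mul (norm_nonneg x), show ((2 : ℕ) : ℝ) * (s / 2 - 1) = s - 2 by push_cast; ring]
  ring

theorem pd_comm (hu : ContDiffAt ℝ ∞ u x) : pd i (pd j u) x = pd j (pd i u) x := by
  have hd : DifferentiableAt ℝ (fderiv ℝ u) x :=
    (hu.fderiv_right (m := 1) (by norm_cast)).differentiableAt (by simp)
  have key : ∀ k l : Fin n, pd k (pd l u) x =
      fderiv ℝ (fderiv ℝ u) x (EuclideanSpace.single k 1) (EuclideanSpace.single l 1) := by
    intro k l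
    have := (hd.hasFDerivAt.clm_apply
      (hasFDerivAt_const (EuclideanSpace.single l (1 : ℝ)) x)).fderiv
    change fderiv ℝ (fun y => fderiv ℝ u y (EuclideanSpace.single l 1)) x _ = _
    rw [this]; simp
  rw [key, key]
  exact (hu.isSymmSndFDerivAt (by
    rw [minSmoothness_of_isRCLikeNormedField]; exact WithTop.coe_le_coe.2 le_top)).eq _ _

protected theorem SmoothHom.pd (hu : SmoothHom a u) (i : Fin n) : SmoothHom (a - 1) (pd i u) :=
  hu.fderiv_apply _

protected theorem ContDiff.pd (hu : ContDiff ℝ ∞ u) (i : Fin n) : ContDiff ℝ ∞ (pd i u) :=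
  (hu.fderiv_right (m := ∞) (by simp)).clm_apply contDiff_const

protected theorem HasCompactSupport.pd (hu : HasCompactSupport u) (i : Fin n) :
    HasCompactSupport (pd i u) :=
  hu.fderiv_apply ℝ (EuclideanSpace.single i 1)

theorem smoothHom_coord (i : Fin n) :
    SmoothHom 1 (fun y : EuclideanSpace ℝ (Fin n) => y i) where
  smooth := (contDiff_coord i).contDiffOn
  hom t ht x hx := by simp

protected theorem SmoothHom.lap (hu : SmoothHom a u) : SmoothHom (a - 2) (lap u) := by
  have h := (SmoothHom.sum Finset.univ fun i => (hu.pd i).pd i).const_mul (-1)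
  rw [show a - 1 - 1 = a - 2 by ring] at h
  exact h.congr fun x _ => by rw [lap_eq_neg_sum_pd]; ring

theorem SmoothHom.sum_coord_mul_pd (hu : SmoothHom a u) (hx : x ≠ 0) :
    ∑ i, x i * pd i u x = a * u x := by
  rw [← smul_eq_mul, ← hu.fderiv_self hx]
  have h := congrArg (fderiv ℝ u x) ((EuclideanSpace.basisFun (Fin n) ℝ).sum_repr x)
  rw [map_sum] at h
  rw [← h]
  simp [pd]

theorem sum_coord_sq : ∑ i, x i * x i = ‖x‖ ^ 2 := by
  rw [EuclideanSpace.norm_sq_eq]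
  exact Finset.sum_congr rfl fun i _ => by rw [norm_eq_abs, sq_abs, sq]

theorem lap_sub (hu : SmoothHom a u) (hv : SmoothHom b v) (hx : x ≠ 0) :
    lap (fun y => u y - v y) x = lap u x - lap v x := by
  simp only [lap_eq_neg_sum_pd]
  have : ∀ i, pd i (pd i fun y => u y - v y) x = pd i (pd i u) x - pd i (pd i v) x := fun i => by
    rw [pd_congr (fun y hy => pd_sub (hu.differentiableAt hy) (hv.differentiableAt hy)) hx,
      pd_sub ((hu.pd i).differentiableAt hx) ((hv.pd i).differentiableAt hx)]
  simp only [this, Finset.sum_sub_distrib]; ring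

theorem pd_lap (hu : SmoothHom a u) (hx : x ≠ 0) : pd j (lap u) x = lap (pd j u) x := by
  have h : lap u = fun y => (-1) * ∑ i, pd i (pd i u) y := by
    funext y; rw [lap_eq_neg_sum_pd]; ring
  have hd : ∀ i, DifferentiableAt ℝ (pd i (pd i u)) x := fun i =>
    ((hu.pd i).pd i).differentiableAt hx
  rw [h, pd_const_mul _ (DifferentiableAt.fun_sum fun i _ => hd i), pd_sum hd, lap_eq_neg_sum_pd,
    neg_one_mul]
  congr 1
  refine Finset.sum_congr rfl fun i _ => ?_
  rw [pd_comm ((hu.pd i).contDiffAt hx)]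
  exact pd_congr (fun y hy => pd_comm (hu.contDiffAt hy)) hx

/-- The Kelvin transform of a homogeneous function intertwines Laplacians. -/
theorem SmoothHom.lap_norm_rpow_mul (hu : SmoothHom a u) (hx : x ≠ 0) {s : ℝ}
    (hs : s = 2 - n - 2 * a) :
    lap (fun y => ‖y‖ ^ s * u y) x = ‖x‖ ^ s * lap u x := by
  have hN : ∀ r : ℝ, ∀ y ≠ 0, DifferentiableAt ℝ
      (fun y : EuclideanSpace ℝ (Fin n) => ‖y‖ ^ r) y :=
    fun r y hy => (smoothHom_norm_rpow r).differentiableAt hy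
  have h1 : ∀ i, ∀ y ≠ 0, pd i (fun y => ‖y‖ ^ s * u y) y =
      ‖y‖ ^ s * pd i u y + s * (y i * (‖y‖ ^ (s - 2) * u y)) := fun i y hy => by
    rw [pd_mul (hN s y hy) (hu.differentiableAt hy), pd_norm_rpow s hy]; ring
  have h2 : ∀ i, pd i (pd i (fun y => ‖y‖ ^ s * u y)) x =
      ‖x‖ ^ s * pd i (pd i u) x + s * ‖x‖ ^ (s - 2) * u x
        + 2 * s * ‖x‖ ^ (s - 2) * (x i * pd i u x)
        + s * (s - 2) * ‖x‖ ^ (s - 4) * u x * (x i * x i) := fun i => by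
    have hc : DifferentiableAt ℝ (fun y : EuclideanSpace ℝ (Fin n) => y i) x := by fun_prop
    have hu' := hu.differentiableAt hx
    have hpu := (hu.pd i).differentiableAt hx
    have hq : DifferentiableAt ℝ (fun y => ‖y‖ ^ (s - 2) * u y) x := (hN (s - 2) x hx).mul hu'
    have hcq : DifferentiableAt ℝ (fun y => y i * (‖y‖ ^ (s - 2) * u y)) x := hc.mul hq
    rw [pd_congr (h1 i) hx, pd_add ((hN s x hx).fun_mul hpu) (hcq.const_mul s),
      pd_mul (hN s x hx) hpu, pd_const_mul s hcq, pd_mul hc hq, pd_mul (hN (s - 2) x hx) hu',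
      pd_norm_rpow s hx, pd_norm_rpow (s - 2) hx, pd_coord, if_pos rfl,
      show s - 2 - 2 = s - 4 by ring]
    ring
  have h3 : ‖x‖ ^ (s - 4) * ‖x‖ ^ 2 = ‖x‖ ^ (s - 2) := by
    rw [← rpow_natCast, ← rpow_add (norm_pos_iff.2 hx)]; congr 1; push_cast; ring
  simp only [lap_eq_neg_sum_pd, h2, Finset.sum_add_distrib, ← Finset.mul_sum,
    hu.sum_coord_mul_pd hx, sum_coord_sq, Finset.sum_const, Finset.card_univ, Fintype.card_fin,
    nsmul_eq_mul]
  have h4 : s * (s - 2) * ‖x‖ ^ (s - 4) * u x * ‖x‖ ^ 2 = s * (s - 2) * ‖x‖ ^ (s - 2) * u x := by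
    rw [← h3]; ring
  rw [h4, hs]; ring

end PartialDerivatives

section Ladder

/-- Surjectivity of the Laplacian from homogeneous functions of degree `a`. -/
def LapSurj (n : ℕ) (a : ℝ) : Prop :=
  ∀ f : EuclideanSpace ℝ (Fin n) → ℝ, SmoothHom (a - 2) f →
    ∃ u : EuclideanSpace ℝ (Fin n) → ℝ, SmoothHom a u ∧ ∀ x ≠ 0, lap u x = f x

/-- Injectivity of the Laplacian on homogeneous functions of degree `a`. -/
def LapInj (n : ℕ) (a : ℝ) : Prop :=
  ∀ u : EuclideanSpace ℝ (Fin n) → ℝ, SmoothHom a u → (∀ x ≠ 0, lap u x = 0) →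
    ∀ x ≠ 0, u x = 0

variable {n : ℕ} {a : ℝ}

theorem SmoothHom.eq_zero_of_pd_eq_zero {u : EuclideanSpace ℝ (Fin n) → ℝ} (hu : SmoothHom a u)
    (ha : a ≠ 0) (h : ∀ i, ∀ x ≠ 0, pd i u x = 0) : ∀ x ≠ 0, u x = 0 := by
  intro x hx
  have := hu.sum_coord_mul_pd hx
  simp only [fun i => h i x hx, mul_zero, Finset.sum_const_zero] at this
  simpa [ha] using this.symm

theorem LapInj.of_sub_one (h : LapInj n (a - 1)) (ha : a ≠ 0) : LapInj n a := by
  intro u hu h0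
  refine hu.eq_zero_of_pd_eq_zero ha fun i => h _ (hu.pd i) fun x hx => ?_
  rw [← pd_lap hu hx, pd_congr (v := fun _ => 0) h0 hx]
  simp [pd]

theorem smoothHom_primitive_of_curl_free {w : Fin n → EuclideanSpace ℝ (Fin n) → ℝ}
    (hw : ∀ i, SmoothHom (a - 1) (w i)) (ha : a ≠ 0)
    (hcurl : ∀ i j, ∀ x ≠ 0, pd j (w i) x = pd i (w j) x) :
    ∃ u, SmoothHom a u ∧ ∀ i, ∀ x ≠ 0, pd i u x = w i x := by
  have hs : ∀ i, SmoothHom a (fun y => y i * w i y) := fun i => by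
    simpa using (smoothHom_coord i).mul (hw i)
  refine ⟨fun x => a⁻¹ * ∑ i, x i * w i x, (SmoothHom.sum _ hs).const_mul _, fun j x hx => ?_⟩
  rw [pd_const_mul _ ((SmoothHom.sum _ hs).differentiableAt hx),
    pd_sum fun i => (hs i).differentiableAt hx]
  have h1 : ∀ i, pd j (fun y => y i * w i y) x =
      x i * pd i (w j) x + w i x * (if j = i then 1 else 0) := fun i => by
    rw [pd_mul ((smoothHom_coord i).differentiableAt hx) ((hw i).differentiableAt hx), pd_coord,
      hcurl i j x hx]
  simp only [h1, Finset.sum_add_distrib, (hw j).sum_coord_mul_pd hx, mul_ite, mul_one, mul_zero,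
    Finset.sum_ite_eq, Finset.mem_univ, if_true]
  field_simp
  ring

theorem LapSurj.of_sub_one (h : LapSurj n (a - 1)) (hinj : LapInj n (a - 2)) (ha : a ≠ 0)
    (ha2 : a - 2 ≠ 0) : LapSurj n a := by
  intro f hf
  have hex : ∀ i, ∃ w : EuclideanSpace ℝ (Fin n) → ℝ,
      SmoothHom (a - 1) w ∧ ∀ x ≠ 0, lap w x = pd i f x := fun i =>
    h _ (by rw [show a - 1 - 2 = a - 2 - 1 by ring]; exact hf.pd i)
  choose w hw hlap using hex
  have hcurl : ∀ i j, ∀ x ≠ 0, pd j (w i) x = pd i (w j) x := by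
    intro i j x hx
    have hj : SmoothHom (a - 2) (pd j (w i)) := by
      rw [show a - 2 = a - 1 - 1 by ring]; exact (hw i).pd j
    have hi : SmoothHom (a - 2) (pd i (w j)) := by
      rw [show a - 2 = a - 1 - 1 by ring]; exact (hw j).pd i
    refine sub_eq_zero.1 (hinj _ (hj.sub hi) (fun y hy => ?_) x hx)
    rw [lap_sub hj hi hy, ← pd_lap (hw i) hy, ← pd_lap (hw j) hy, pd_congr (hlap i) hy,
      pd_congr (hlap j) hy, pd_comm (hf.contDiffAt hy), sub_self]
  obtain ⟨u, hu, hpd⟩ := smoothHom_primitive_of_curl_free hw ha hcurl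
  refine ⟨u, hu, fun x hx => sub_eq_zero.1 ?_⟩
  refine (hu.lap.sub hf).eq_zero_of_pd_eq_zero ha2 (fun i y hy => ?_) x hx
  rw [pd_sub (hu.lap.differentiableAt hy) (hf.differentiableAt hy), pd_lap hu hy,
    lap_congr (hpd i) hy, hlap i y hy, sub_self]

theorem SmoothHom.kelvin {u : EuclideanSpace ℝ (Fin n) → ℝ} (hu : SmoothHom a u) :
    SmoothHom (2 - n - a) (fun y => ‖y‖ ^ (2 - n - 2 * a) * u y) := by
  have := (smoothHom_norm_rpow (2 - n - 2 * a)).mul hu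
  rwa [show 2 - n - 2 * a + a = 2 - n - a by ring] at this

theorem LapInj.kelvin (h : LapInj n (2 - n - a)) : LapInj n a := by
  intro u hu h0 x hx
  have h1 := h _ hu.kelvin (fun y hy => by rw [hu.lap_norm_rpow_mul hy rfl, h0 y hy, mul_zero]) x hx
  exact (mul_eq_zero.1 h1).resolve_left (rpow_pos_of_pos (norm_pos_iff.2 hx) _).ne'

theorem LapSurj.kelvin (h : LapSurj n (2 - n - a)) : LapSurj n a := by
  intro f hf
  have hf' : SmoothHom (2 - n - a - 2) (fun y => ‖y‖ ^ (2 - n - 2 * a) * f y) := by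
    have := (smoothHom_norm_rpow (2 - n - 2 * a)).mul hf
    rwa [show 2 - n - 2 * a + (a - 2) = 2 - n - a - 2 by ring] at this
  obtain ⟨v, hv, hlap⟩ := h _ hf'
  have hu := hv.kelvin
  rw [show 2 - n - (2 - n - a) = a by ring] at hu
  refine ⟨_, hu, fun x hx => ?_⟩
  rw [hv.lap_norm_rpow_mul hx rfl, hlap x hx, ← mul_assoc, ← rpow_add (norm_pos_iff.2 hx)]
  ring_nf
  simp

/-- A property of nonintegral degrees that holds on `(0, 1)` and is stable under the unit shift and
under the Kelvin reflection holds for all nonintegral degrees. -/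
theorem nonintegral_induction {P : ℝ → Prop} (n : ℕ) (h01 : ∀ a, 0 < a → a < 1 → P a)
    (hstep : ∀ a : ℝ, (∀ m : ℤ, a ≠ m) → P (a - 1) → P a)
    (hkelvin : ∀ a, P (2 - n - a) → P a) {a : ℝ} (ha : ∀ m : ℤ, a ≠ m) : P a := by
  have shift : ∀ b : ℝ, (∀ m : ℤ, b ≠ m) → ∀ k : ℕ, P (b - k) → P b := by
    intro b hb k
    induction k with
    | zero => simp
    | succ k ih =>
      intro h
      refine ih (hstep _ (fun m hm => hb (m + k) ?_) ?_)
      · push_cast; linarith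
      · rwa [show b - (k : ℝ) - 1 = b - ((k + 1 : ℕ) : ℝ) by push_cast; ring]
  have pos : ∀ b : ℝ, (∀ m : ℤ, b ≠ m) → 0 < b → P b := by
    intro b hb hb0
    have hfl : ((⌊b⌋.toNat : ℕ) : ℝ) = ⌊b⌋ := by
      exact_mod_cast Int.toNat_of_nonneg (Int.floor_nonneg.2 hb0.le)
    refine shift b hb ⌊b⌋.toNat (h01 _ ?_ ?_)
    · rw [hfl]
      exact sub_pos.2 (lt_of_le_of_ne (Int.floor_le b) fun h => hb _ h.symm)
    · rw [hfl]
      linarith [Int.lt_floor_add_one b]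
  obtain ⟨k, hk⟩ := exists_nat_gt (n + a)
  refine shift a ha k (hkelvin _ (pos _ (fun m hm => ha (2 - n + k - m) ?_) ?_))
  · push_cast; linarith
  · linarith

theorem LapInj.of_nonintegral (h01 : ∀ a, 0 < a → a < 1 → LapInj n a) (ha : ∀ m : ℤ, a ≠ m) :
    LapInj n a :=
  nonintegral_induction n h01 (fun b hb h => h.of_sub_one (by simpa using hb 0))
    (fun _ h => h.kelvin) ha

theorem LapSurj.of_nonintegral (h01 : ∀ a, 0 < a → a < 1 → LapSurj n a)
    (hinj : ∀ a : ℝ, (∀ m : ℤ, a ≠ m) → LapInj n a) (ha : ∀ m : ℤ, a ≠ m) : LapSurj n a :=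
  nonintegral_induction n h01
    (fun b hb h => h.of_sub_one
      (hinj _ fun m hm => hb (m + 2) (by push_cast; linarith)) (by simpa using hb 0)
      (sub_ne_zero.2 (by exact_mod_cast hb 2)))
    (fun _ h => h.kelvin) ha

theorem lapIter_congr (k : ℕ) {u v : EuclideanSpace ℝ (Fin n) → ℝ} (h : ∀ y ≠ 0, u y = v y) :
    ∀ x ≠ 0, lapIter k u x = lapIter k v x := by
  induction k generalizing u v with
  | zero => exact h
  | succ k ih => exact ih fun y hy => lap_congr h hy

theorem lapIter_surj (hsurj : ∀ a : ℝ, (∀ m : ℤ, a ≠ m) → LapSurj n a) (k : ℕ)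
    (ha : ∀ m : ℤ, a ≠ m) {f : EuclideanSpace ℝ (Fin n) → ℝ} (hf : SmoothHom (a - 2 * k) f) :
    ∃ u, SmoothHom a u ∧ ∀ x ≠ 0, lapIter k u x = f x := by
  induction k generalizing a with
  | zero => exact ⟨f, by simpa using hf, fun x _ => rfl⟩
  | succ k ih =>
    obtain ⟨v, hv, hlap⟩ := ih (a := a - 2) (fun m hm => ha (m + 2) (by push_cast; linarith))
      (by convert hf using 1; push_cast; ring)
    obtain ⟨u, hu, hu'⟩ := hsurj a ha v hv
    exact ⟨u, hu, fun x hx => (lapIter_congr k hu' x hx).trans (hlap x hx)⟩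

theorem lapIter_inj (hinj : ∀ a : ℝ, (∀ m : ℤ, a ≠ m) → LapInj n a) (k : ℕ)
    (ha : ∀ m : ℤ, a ≠ m) {u v : EuclideanSpace ℝ (Fin n) → ℝ} (hu : SmoothHom a u)
    (hv : SmoothHom a v) (h : ∀ x ≠ 0, lapIter k u x = lapIter k v x) : ∀ x ≠ 0, u x = v x := by
  induction k generalizing a u v with
  | zero => exact h
  | succ k ih =>
    have h1 := ih (a := a - 2) (fun m hm => ha (m + 2) (by push_cast; linarith)) hu.lap hv.lap h
    refine fun x hx => sub_eq_zero.1 (hinj a ha _ (hu.sub hv) (fun y hy => ?_) x hx)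
    rw [lap_sub hu hv hy, h1 y hy, sub_self]

end Ladder

section IntegrationByParts

variable {n : ℕ} {a : ℝ}

theorem integral_pd_eq_zero {φ : EuclideanSpace ℝ (Fin n) → ℝ} (hφ : ContDiff ℝ ∞ φ)
    (hc : HasCompactSupport φ) (i : Fin n) : ∫ x, pd i φ x = 0 := by
  have h := integral_mul_fderiv_eq_neg_fderiv_mul_of_integrable (μ := volume)
    (f := fun _ : EuclideanSpace ℝ (Fin n) => (1 : ℝ)) (g := φ) (v := EuclideanSpace.single i 1)
    (by simp)
    (by simp only [one_mul]; exact (hφ.pd i).continuous.integrable_of_hasCompactSupport (hc.pd i))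
    (by simpa using hφ.continuous.integrable_of_hasCompactSupport hc)
    (fun x _ => by fun_prop) (fun x _ => hφ.differentiable (by simp) x)
  simpa [pd] using h

theorem integral_mul_pd_eq_neg {u φ : EuclideanSpace ℝ (Fin n) → ℝ} (hφ : ContDiff ℝ ∞ φ)
    (hc : HasCompactSupport φ) (hu : ∀ x ∈ tsupport φ, DifferentiableAt ℝ u x)
    (hprod : ContDiff ℝ ∞ (fun x => φ x * u x)) (i : Fin n)
    (hint : Integrable (fun x => u x * pd i φ x)) :
    ∫ x, u x * pd i φ x = -∫ x, pd i u x * φ x := by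
  have hc' : HasCompactSupport (fun x => φ x * u x) := hc.mul_right
  have hsum : ∀ x, pd i (fun x => φ x * u x) x = u x * pd i φ x + pd i u x * φ x := by
    intro x
    by_cases hx : x ∈ tsupport φ
    · rw [pd_mul (hφ.differentiable (by simp) x) (hu x hx)]; ring
    · have h1 := notMem_tsupport_iff_eventuallyEq.1 hx
      have h2 : (fun x => φ x * u x) =ᶠ[𝓝 x] fun _ => 0 := by
        filter_upwards [h1] with y hy
        simp [hy]
      have h3 : pd i φ x = 0 := by rw [pd, h1.fderiv_eq]; simp
      rw [h3, h1.eq_of_nhds, pd, h2.fderiv_eq]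
      simp
  have h0 := integral_pd_eq_zero hprod hc' i
  have hI : Integrable (fun x => pd i (fun x => φ x * u x) x) :=
    (hprod.pd i).continuous.integrable_of_hasCompactSupport (hc'.pd i)
  have hI2 : Integrable (fun x => pd i u x * φ x) := by
    refine (hI.sub hint).congr (Eventually.of_forall fun x => ?_)
    simp [hsum x]
  simp only [hsum] at h0
  rw [integral_add hint hI2] at h0
  linarith

theorem SmoothHom.integral_mul_pd {u φ : EuclideanSpace ℝ (Fin n) → ℝ} (hu : SmoothHom a u)
    (hφ : ContDiff ℝ ∞ φ) (hc : HasCompactSupport φ)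
    (h0 : (0 : EuclideanSpace ℝ (Fin n)) ∉ tsupport φ) (i : Fin n) :
    ∫ x, u x * pd i φ x = -∫ x, pd i u x * φ x := by
  have hsub : tsupport (pd i φ) ⊆ tsupport φ := tsupport_fderiv_apply_subset ℝ _
  refine integral_mul_pd_eq_neg hφ hc (fun x hx => hu.differentiableAt ?_)
    (hu.contDiff_mul hφ h0) i ?_
  · rintro rfl; exact h0 hx
  · simp only [mul_comm (u _)]
    exact (hu.contDiff_mul (hφ.pd i) fun h => h0 (hsub h)).continuous
      |>.integrable_of_hasCompactSupport (hc.pd i).mul_right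

/-- A smooth radial bump function supported in an annulus. -/
theorem exists_radial_cutoff (n : ℕ) : ∃ ρ : ℝ → ℝ, ContDiff ℝ ∞ ρ ∧ (∀ r, 0 ≤ ρ r) ∧ ρ 1 = 1 ∧
    HasCompactSupport (fun x : EuclideanSpace ℝ (Fin n) => ρ (‖x‖ ^ 2)) ∧
    (0 : EuclideanSpace ℝ (Fin n)) ∉
      tsupport (fun x : EuclideanSpace ℝ (Fin n) => ρ (‖x‖ ^ 2)) := by
  let ρ : ContDiffBump (1 : ℝ) := ⟨1 / 4, 1 / 2, by norm_num, by norm_num⟩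
  have hz : ∀ r : ℝ, 1 / 2 ≤ |r - 1| → ρ r = 0 := fun r hr =>
    ρ.zero_of_le_dist (by rw [Real.dist_eq]; exact hr)
  refine ⟨ρ, ρ.contDiff, fun r => ρ.nonneg, ?_, ?_, ?_⟩
  · exact ρ.one_of_mem_closedBall (by simp [ρ])
  · refine HasCompactSupport.intro (isCompact_closedBall (0 : EuclideanSpace ℝ (Fin n)) 2)
      fun x hx => hz _ ?_
    have hx' : 2 < ‖x‖ := by simpa using hx
    rw [abs_of_pos (by nlinarith)]
    nlinarith
  · rw [notMem_tsupport_iff_eventuallyEq]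
    filter_upwards [ball_mem_nhds (0 : EuclideanSpace ℝ (Fin n)) (show (0 : ℝ) < 1 / 2 by norm_num)]
      with x hx
    have hx' : ‖x‖ < 1 / 2 := by simpa using hx
    refine hz _ ?_
    rw [abs_of_neg (by nlinarith [norm_nonneg x])]
    nlinarith [norm_nonneg x]

/-- The Laplacian is symmetric on homogeneous functions of a given degree. -/
theorem SmoothHom.integral_green {u w : EuclideanSpace ℝ (Fin n) → ℝ} (hu : SmoothHom a u)
    (hw : SmoothHom a w) {ρ : ℝ → ℝ} (hρ : ContDiff ℝ ∞ ρ)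
    (hc : HasCompactSupport (fun x : EuclideanSpace ℝ (Fin n) => ρ (‖x‖ ^ 2)))
    (h0 : (0 : EuclideanSpace ℝ (Fin n)) ∉
      tsupport (fun x : EuclideanSpace ℝ (Fin n) => ρ (‖x‖ ^ 2))) :
    ∫ x, ρ (‖x‖ ^ 2) * (w x * lap u x - u x * lap w x) = 0 := by
  have hχ : ContDiff ℝ ∞ (fun x : EuclideanSpace ℝ (Fin n) => ρ (‖x‖ ^ 2)) :=
    hρ.comp (contDiff_norm_sq ℝ)
  have hg : ∀ i, SmoothHom (a + (a - 1)) (fun x => u x * pd i w x - w x * pd i u x) := fun i =>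
    (hu.mul (hw.pd i)).sub (hw.mul (hu.pd i))
  have hsm := fun i => (hg i).contDiff_mul hχ h0
  have hcs : ∀ i, HasCompactSupport
      (fun x => ρ (‖x‖ ^ 2) * (u x * pd i w x - w x * pd i u x)) := fun i => hc.mul_right
  have hsum : ∀ x, ∑ i, pd i (fun x => ρ (‖x‖ ^ 2) * (u x * pd i w x - w x * pd i u x)) x =
      ρ (‖x‖ ^ 2) * (w x * lap u x - u x * lap w x) := by
    intro x
    by_cases hx : x = 0
    · subst hx
      have h1 := notMem_tsupport_iff_eventuallyEq.1 h0
      have h2 : ∀ i, (fun x => ρ (‖x‖ ^ 2) * (u x * pd i w x - w x * pd i u x))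
          =ᶠ[𝓝 0] fun _ => 0 := fun i => by
        filter_upwards [h1] with y hy
        rw [hy]; simp
      rw [show ρ (‖(0 : EuclideanSpace ℝ (Fin n))‖ ^ 2) = 0 from h1.eq_of_nhds, zero_mul]
      refine Finset.sum_eq_zero fun i _ => ?_
      rw [pd, (h2 i).fderiv_eq]; simp
    · have hi : ∀ i, pd i (fun x => ρ (‖x‖ ^ 2) * (u x * pd i w x - w x * pd i u x)) x =
          ρ (‖x‖ ^ 2) * (u x * pd i (pd i w) x - w x * pd i (pd i u) x) +
          2 * deriv ρ (‖x‖ ^ 2) * (u x * (x i * pd i w x) - w x * (x i * pd i u x)) := by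
        intro i
        rw [pd_mul (hχ.differentiable (by simp) x) ((hg i).differentiableAt hx),
          pd_sub ((hu.mul (hw.pd i)).differentiableAt hx)
            ((hw.mul (hu.pd i)).differentiableAt hx),
          pd_mul (hu.differentiableAt hx) ((hw.pd i).differentiableAt hx),
          pd_mul (hw.differentiableAt hx) ((hu.pd i).differentiableAt hx),
          pd_comp (g := ρ) (hρ.differentiable (by simp) _)
            (hasStrictFDerivAt_norm_sq x).differentiableAt, pd_norm_sq]
        ring
      simp only [hi, Finset.sum_add_distrib, ← Finset.mul_sum, Finset.sum_sub_distrib,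
        hu.sum_coord_mul_pd hx, hw.sum_coord_mul_pd hx, lap_eq_neg_sum_pd]
      ring
  simp only [← hsum]
  rw [integral_finsetSum _ fun i _ =>
    ((hsm i).pd i).continuous.integrable_of_hasCompactSupport ((hcs i).pd i)]
  exact Finset.sum_eq_zero fun i _ => integral_pd_eq_zero (hsm i) (hcs i) i

theorem LapSurj.lapInj (h : LapSurj n a) : LapInj n a := by
  intro u hu hlap
  have hf : SmoothHom (a - 2) (fun x => ‖x‖ ^ (-2 : ℝ) * u x) := by
    have := (smoothHom_norm_rpow (-2)).mul hu
    rwa [show -2 + a = a - 2 by ring] at this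
  obtain ⟨w, hw, hlw⟩ := h _ hf
  obtain ⟨ρ, hρ, hρ0, hρ1, hc, h0⟩ := exists_radial_cutoff n
  have hχ : ContDiff ℝ ∞ (fun x : EuclideanSpace ℝ (Fin n) => ρ (‖x‖ ^ 2)) :=
    hρ.comp (contDiff_norm_sq ℝ)
  have hq := hf.mul hu
  have hsm := (hq.contDiff_mul hχ h0).continuous
  have hnn : ∀ x, 0 ≤ ρ (‖x‖ ^ 2) * (‖x‖ ^ (-2 : ℝ) * u x * u x) := fun x =>
    mul_nonneg (hρ0 _) (by rw [mul_assoc]; exact mul_nonneg (by positivity) (mul_self_nonneg _))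
  have hint : ∫ x, ρ (‖x‖ ^ 2) * (‖x‖ ^ (-2 : ℝ) * u x * u x) = 0 := by
    rw [← neg_eq_zero, ← integral_neg, ← hu.integral_green hw hρ hc h0]
    refine integral_congr_ae (Eventually.of_forall fun x => ?_)
    by_cases hx : x = 0
    · subst hx
      have h1 : ρ (‖(0 : EuclideanSpace ℝ (Fin n))‖ ^ 2) = 0 :=
        (notMem_tsupport_iff_eventuallyEq.1 h0).eq_of_nhds
      simp only [h1, zero_mul, neg_zero]
    · simp only [hlap x hx, hlw x hx]; ring
  have hz := Continuous.ae_eq_iff_eq volume hsm continuous_zero |>.1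
    ((integral_eq_zero_iff_of_nonneg hnn
      (hsm.integrable_of_hasCompactSupport hc.mul_right)).1 hint)
  intro x hx
  have hx' : 0 < ‖x‖ := norm_pos_iff.2 hx
  have hy := congrFun hz (‖x‖⁻¹ • x)
  have hn1 : ‖‖x‖⁻¹ • x‖ = 1 := by simp [norm_smul, hx'.ne']
  simp only [hn1, one_pow, hρ1, one_rpow, one_mul, Pi.zero_apply, mul_self_eq_zero] at hy
  rw [hu.hom _ (inv_pos.2 hx') x hx] at hy
  exact (smul_eq_zero.1 hy).resolve_left (rpow_pos_of_pos (inv_pos.2 hx') _).ne'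

end IntegrationByParts

section Kernel

variable {n : ℕ}

/-- The `i`-th component of the gradient of the Newtonian potential, up to normalization. -/
noncomputable def newtonKer (i : Fin n) (x : EuclideanSpace ℝ (Fin n)) : ℝ :=
  x i * ‖x‖ ^ (-n : ℝ)

/-- A smooth regularization of `newtonKer` at scale `c⁻¹`. -/
noncomputable def newtonKerReg (c : ℝ) (i : Fin n) (x : EuclideanSpace ℝ (Fin n)) : ℝ :=
  x i * (‖x‖ ^ 2 + (c⁻¹) ^ 2) ^ (-n / 2 : ℝ)

theorem smoothHom_newtonKer (i : Fin n) : SmoothHom (1 - n : ℝ) (newtonKer i) := by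
  rw [sub_eq_add_neg]
  exact (smoothHom_coord i).mul (smoothHom_norm_rpow (-n : ℝ))

theorem ae_ne_zero (hn : 2 ≤ n) : ∀ᵐ x : EuclideanSpace ℝ (Fin n), x ≠ 0 := by
  have : Nontrivial (EuclideanSpace ℝ (Fin n)) :=
    Module.nontrivial_of_finrank_pos (R := ℝ) (by rw [finrank_euclideanSpace_fin]; omega)
  exact compl_mem_ae_iff.2 (measure_singleton 0)

theorem SmoothHom.locallyIntegrable (hn : 2 ≤ n) {a : ℝ} {u : EuclideanSpace ℝ (Fin n) → ℝ}
    (hu : SmoothHom a u) (ha : -n < a) : LocallyIntegrable u := by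
  obtain ⟨C, -, hC⟩ := hu.exists_norm_le
  refine locallyIntegrable_of_norm_le_rpow (C := C) (α := -a)
    (by rw [finrank_euclideanSpace_fin]; omega)
    (by rw [finrank_euclideanSpace_fin]; linarith) ?_ hu.measurable.aestronglyMeasurable
  filter_upwards [ae_ne_zero hn] with x hx
  simpa using hC x hx

theorem locallyIntegrable_newtonKer (hn : 2 ≤ n) (i : Fin n) :
    LocallyIntegrable (newtonKer i) :=
  (smoothHom_newtonKer i).locallyIntegrable hn (by linarith)

theorem abs_newtonKerReg_le (c : ℝ) (i : Fin n) (x : EuclideanSpace ℝ (Fin n)) :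
    |newtonKerReg c i x| ≤ |newtonKer i x| := by
  by_cases hx : x = 0
  · simp [hx, newtonKerReg]
  have hx' : 0 < ‖x‖ := norm_pos_iff.2 hx
  rw [newtonKerReg, newtonKer, abs_mul, abs_mul,
    abs_of_nonneg (a := (‖x‖ ^ 2 + (c⁻¹) ^ 2) ^ (-n / 2 : ℝ)) (by positivity),
    abs_of_nonneg (a := ‖x‖ ^ (-n : ℝ)) (by positivity)]
  refine mul_le_mul_of_nonneg_left ?_ (abs_nonneg _)
  have h : ‖x‖ ^ (-n : ℝ) = (‖x‖ ^ 2) ^ (-n / 2 : ℝ) := by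
    rw [← rpow_natCast, ← rpow_mul hx'.le]
    congr 1; push_cast; ring
  rw [h]
  exact rpow_le_rpow_of_nonpos (by positivity) (by nlinarith [sq_nonneg c⁻¹])
    (by rw [neg_div]; exact neg_nonpos.2 (by positivity))

theorem tendsto_newtonKerReg (i : Fin n) (x : EuclideanSpace ℝ (Fin n)) :
    Tendsto (fun c => newtonKerReg c i x) atTop (𝓝 (newtonKer i x)) := by
  by_cases hx : x = 0
  · simp [hx, newtonKerReg, newtonKer]
  have hx' : 0 < ‖x‖ := norm_pos_iff.2 hx
  have h : newtonKer i x = x i * (‖x‖ ^ 2 + 0 ^ 2) ^ (-n / 2 : ℝ) := by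
    rw [newtonKer, zero_pow two_ne_zero, add_zero, ← rpow_natCast, ← rpow_mul hx'.le]
    congr 2; push_cast; ring
  rw [h]
  refine Tendsto.const_mul _ (Tendsto.rpow_const ?_ (Or.inl (by positivity)))
  exact tendsto_const_nhds.add (tendsto_inv_atTop_zero.pow 2)

theorem tendsto_integral_newtonKerReg (hn : 2 ≤ n) (i : Fin n)
    {ψ : EuclideanSpace ℝ (Fin n) → ℝ} (hψ : Continuous ψ) (hc : HasCompactSupport ψ) :
    Tendsto (fun c => ∫ x, newtonKerReg c i x * ψ x) atTop (𝓝 (∫ x, newtonKer i x * ψ x)) := by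
  have hint : Integrable (fun x => newtonKer i x * ψ x) := by
    simpa [mul_comm] using
      (locallyIntegrable_newtonKer hn i).integrable_smul_left_of_hasCompactSupport hψ hc
  refine tendsto_integral_filter_of_dominated_convergence (fun x => ‖newtonKer i x * ψ x‖)
    (Eventually.of_forall fun c => ?_) (Eventually.of_forall fun c => ?_) hint.norm
    (Eventually.of_forall fun x => (tendsto_newtonKerReg i x).mul_const _)
  · refine Measurable.aestronglyMeasurable ?_
    unfold newtonKerReg
    exact ((contDiff_coord i).continuous.measurable.mul (by fun_prop)).mul hψ.measurable
  · refine Eventually.of_forall fun x => ?_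
    rw [norm_mul, norm_mul]
    gcongr
    exact abs_newtonKerReg_le c i x

theorem contDiff_newtonKerReg {c : ℝ} (hc : 0 < c) (i : Fin n) :
    ContDiff ℝ ∞ (newtonKerReg c i) :=
  (contDiff_coord i).mul (((contDiff_norm_sq ℝ).add contDiff_const).rpow_const_of_ne
    fun x => by positivity)

theorem pd_newtonKerReg {c : ℝ} (hc : 0 < c) (i j : Fin n) (x : EuclideanSpace ℝ (Fin n)) :
    pd j (newtonKerReg c i) x = (if j = i then (‖x‖ ^ 2 + (c⁻¹) ^ 2) ^ (-n / 2 : ℝ) else 0) -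
      n * (x i * x j) * (‖x‖ ^ 2 + (c⁻¹) ^ 2) ^ (-n / 2 - 1 : ℝ) := by
  have hq : DifferentiableAt ℝ (fun y : EuclideanSpace ℝ (Fin n) => ‖y‖ ^ 2 + (c⁻¹) ^ 2) x :=
    (hasStrictFDerivAt_norm_sq x).differentiableAt.add_const _
  have hne : ‖x‖ ^ 2 + (c⁻¹) ^ 2 ≠ 0 := by positivity
  have hr := hasDerivAt_rpow_const (p := (-n / 2 : ℝ)) (Or.inl hne)
  have hpq : pd j (fun y : EuclideanSpace ℝ (Fin n) => ‖y‖ ^ 2 + (c⁻¹) ^ 2) x = 2 * x j := by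
    rw [← pd_norm_sq, pd, pd, fderiv_add_const]
  have hd : DifferentiableAt ℝ
      (fun y : EuclideanSpace ℝ (Fin n) => (‖y‖ ^ 2 + (c⁻¹) ^ 2) ^ (-n / 2 : ℝ)) x :=
    hq.rpow_const (Or.inl hne)
  unfold newtonKerReg
  rw [pd_mul ((contDiff_coord i).differentiable (by simp) x) hd,
    pd_comp (g := fun r => r ^ (-n / 2 : ℝ)) hr.differentiableAt hq, hr.deriv, hpq, pd_coord]
  split_ifs <;> ring

theorem integral_newtonKerReg_mul_pd {c : ℝ} (hc : 0 < c) (i j : Fin n)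
    {φ : EuclideanSpace ℝ (Fin n) → ℝ} (hφ : ContDiff ℝ ∞ φ) (hs : HasCompactSupport φ) :
    ∫ x, newtonKerReg c i x * pd j φ x = -∫ x, pd j (newtonKerReg c i) x * φ x := by
  have hk := contDiff_newtonKerReg hc i
  exact integral_mul_pd_eq_neg hφ hs (fun x _ => hk.differentiable (by simp) x) (hφ.mul hk) j
    ((hk.continuous.mul (hφ.pd j).continuous).integrable_of_hasCompactSupport (hs.pd j).mul_left)

theorem integral_newtonKer_mul_pd_comm (hn : 2 ≤ n) (i j : Fin n)
    {φ : EuclideanSpace ℝ (Fin n) → ℝ} (hφ : ContDiff ℝ ∞ φ) (hs : HasCompactSupport φ) :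
    ∫ x, newtonKer i x * pd j φ x = ∫ x, newtonKer j x * pd i φ x := by
  refine tendsto_nhds_unique
    (tendsto_integral_newtonKerReg hn i (hφ.pd j).continuous (hs.pd j))
    ((tendsto_integral_newtonKerReg hn j (hφ.pd i).continuous (hs.pd i)).congr' ?_)
  filter_upwards [eventually_gt_atTop 0] with c hc
  rw [integral_newtonKerReg_mul_pd hc i j hφ hs, integral_newtonKerReg_mul_pd hc j i hφ hs]
  simp only [pd_newtonKerReg hc, eq_comm (a := j) (b := i), mul_comm]

theorem sum_pd_newtonKerReg {c : ℝ} (hc : 0 < c) (x : EuclideanSpace ℝ (Fin n)) :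
    ∑ i, pd i (newtonKerReg c i) x =
      n * (c ^ n * (1 + ‖c • x‖ ^ 2) ^ (-(n + 2 : ℝ) / 2)) := by
  have hq : 0 < ‖x‖ ^ 2 + (c⁻¹) ^ 2 := by positivity
  have h1 : (‖x‖ ^ 2 + (c⁻¹) ^ 2) ^ (-n / 2 : ℝ) =
      (‖x‖ ^ 2 + (c⁻¹) ^ 2) * (‖x‖ ^ 2 + (c⁻¹) ^ 2) ^ (-n / 2 - 1 : ℝ) := by
    rw [rpow_sub_one hq.ne']; field_simp
  have h2 : (1 + ‖c • x‖ ^ 2) = c ^ 2 * (‖x‖ ^ 2 + (c⁻¹) ^ 2) := by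
    rw [norm_smul, norm_of_nonneg hc.le]; field_simp; ring
  have h3 : (c ^ 2) ^ (-(n + 2 : ℝ) / 2) = (c ^ n)⁻¹ * (c⁻¹) ^ 2 := by
    rw [← rpow_natCast, ← rpow_mul hc.le,
      show ((2 : ℕ) : ℝ) * (-(n + 2 : ℝ) / 2) = -((n + 2 : ℕ) : ℝ) by push_cast; ring,
      rpow_neg hc.le, rpow_natCast, pow_add, mul_inv, inv_pow]
  have h4 : (-n / 2 - 1 : ℝ) = -(n + 2 : ℝ) / 2 := by ring
  simp only [pd_newtonKerReg hc, if_true, Finset.sum_sub_distrib, Finset.sum_const,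
    Finset.card_univ, Fintype.card_fin, nsmul_eq_mul, ← Finset.sum_mul, ← Finset.mul_sum,
    sum_coord_sq]
  rw [h1, h4, h2, mul_rpow (by positivity) hq.le, h3]
  have hcn : c ^ n ≠ 0 := by positivity
  field_simp
  ring

theorem exists_sum_integral_newtonKer_mul_pd (hn : 2 ≤ n) : ∃ c : ℝ, 0 < c ∧
    ∀ φ : EuclideanSpace ℝ (Fin n) → ℝ, ContDiff ℝ ∞ φ → HasCompactSupport φ →
      ∑ i, ∫ x, newtonKer i x * pd i φ x = -(c * φ 0) := by
  let Φ : EuclideanSpace ℝ (Fin n) → ℝ := fun x => (1 + ‖x‖ ^ 2) ^ (-(n + 2 : ℝ) / 2)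
  have hΦ0 : ∀ x, 0 < Φ x := fun x => by
    change 0 < (1 + ‖x‖ ^ 2) ^ (-(n + 2 : ℝ) / 2)
    positivity
  have hΦc : Continuous Φ :=
    (continuous_const.add (continuous_norm.pow 2)).rpow_const fun x =>
      Or.inl (show (1 + ‖x‖ ^ 2 : ℝ) ≠ 0 by positivity)
  have hΦi : Integrable Φ := integrable_rpow_neg_one_add_norm_sq
    (by rw [finrank_euclideanSpace_fin]; linarith)
  set I := ∫ x, Φ x with hI
  have hIpos : 0 < I := by
    refine lt_of_le_of_ne (integral_nonneg fun x => (hΦ0 x).le) fun h => ?_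
    have hz := Continuous.ae_eq_iff_eq volume hΦc continuous_zero |>.1
      ((integral_eq_zero_iff_of_nonneg (fun x => (hΦ0 x).le) hΦi).1 h.symm)
    exact (hΦ0 0).ne' (congrFun hz 0)
  have hlim : Tendsto (fun x : EuclideanSpace ℝ (Fin n) =>
      ‖x‖ ^ Module.finrank ℝ (EuclideanSpace ℝ (Fin n)) * (I⁻¹ * Φ x))
      (Bornology.cobounded _) (𝓝 0) := by
    rw [finrank_euclideanSpace_fin]
    have h1 : Tendsto (fun x : EuclideanSpace ℝ (Fin n) => I⁻¹ * (1 + ‖x‖ ^ 2)⁻¹)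
        (Bornology.cobounded _) (𝓝 0) := by
      rw [← mul_zero I⁻¹]
      refine Tendsto.const_mul _ (tendsto_inv_atTop_zero.comp ?_)
      exact tendsto_atTop_add_const_left _ _
        ((tendsto_pow_atTop two_ne_zero).comp tendsto_norm_cobounded_atTop)
    refine squeeze_zero (fun x => by have := hΦ0 x; positivity) (fun x => ?_) h1
    rw [mul_left_comm]
    gcongr
    have hp : (0 : ℝ) < 1 + ‖x‖ ^ 2 := by positivity
    have h2 : ‖x‖ ^ n ≤ (1 + ‖x‖ ^ 2) ^ (n / 2 : ℝ) := by
      have : ‖x‖ ^ n = (‖x‖ ^ 2) ^ (n / 2 : ℝ) := by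
        rw [← rpow_natCast, ← rpow_natCast, ← rpow_mul (norm_nonneg x)]
        congr 1; push_cast; ring
      rw [this]
      exact rpow_le_rpow (by positivity) (by linarith) (by positivity)
    calc ‖x‖ ^ n * Φ x ≤ (1 + ‖x‖ ^ 2) ^ (n / 2 : ℝ) * Φ x := by
          gcongr
      _ = (1 + ‖x‖ ^ 2)⁻¹ := by
          rw [← rpow_add hp, ← rpow_neg_one]; congr 1; ring
  refine ⟨n * I, by positivity, fun φ hφ hs => ?_⟩
  have hpeak := tendsto_integral_comp_smul_smul_of_integrable (μ := volume)
    (φ := fun x => I⁻¹ * Φ x) (fun x => by have := hΦ0 x; positivity)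
    (by rw [integral_const_mul, ← hI, inv_mul_cancel₀ hIpos.ne']) hlim
    (hφ.continuous.integrable_of_hasCompactSupport hs) hφ.continuous.continuousAt
  rw [finrank_euclideanSpace_fin] at hpeak
  have hsum : Tendsto (fun c => ∑ i, ∫ x, newtonKerReg c i x * pd i φ x) atTop
      (𝓝 (∑ i, ∫ x, newtonKer i x * pd i φ x)) :=
    tendsto_finsetSum _ fun i _ =>
      tendsto_integral_newtonKerReg hn i (hφ.pd i).continuous (hs.pd i)
  refine tendsto_nhds_unique hsum ?_
  have hgoal := (hpeak.const_mul (n * I : ℝ)).neg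
  refine hgoal.congr' ?_
  filter_upwards [eventually_gt_atTop 0] with c hc
  simp only [integral_newtonKerReg_mul_pd hc _ _ hφ hs, Finset.sum_neg_distrib]
  rw [← integral_finsetSum, ← integral_const_mul]
  · congr 1
    refine integral_congr_ae (Eventually.of_forall fun x => ?_)
    simp only [← Finset.sum_mul, sum_pd_newtonKerReg hc, smul_eq_mul, Φ]
    field_simp
  · intro i _
    exact (((contDiff_newtonKerReg hc i).pd i).continuous.mul
      hφ.continuous).integrable_of_hasCompactSupport hs.mul_left

end Kernel

section Potential

variable {n : ℕ} {a b : ℝ}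

theorem integrable_one_add_norm_rpow_mul_norm_rpow (hn : 2 ≤ n) (hb : -2 < b) (hb' : b < -1) :
    Integrable fun y : EuclideanSpace ℝ (Fin n) => (1 + ‖y‖) ^ (1 - n : ℝ) * ‖y‖ ^ b := by
  have hn' : (2 : ℝ) ≤ n := by exact_mod_cast hn
  have hloc : LocallyIntegrable fun y : EuclideanSpace ℝ (Fin n) => ‖y‖ ^ b :=
    (smoothHom_norm_rpow b).locallyIntegrable hn (by linarith)
  have hnear : Integrable (indicator (closedBall (0 : EuclideanSpace ℝ (Fin n)) 1)
      fun y => ‖y‖ ^ b) :=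
    (hloc.integrableOn_isCompact (isCompact_closedBall _ _)).integrable_indicator
      measurableSet_closedBall
  have hfar : Integrable fun y : EuclideanSpace ℝ (Fin n) =>
      (2 : ℝ) ^ (-b) * (1 + ‖y‖) ^ (-(n - 1 - b)) :=
    (integrable_one_add_norm (by rw [finrank_euclideanSpace_fin]; linarith)).const_mul _
  refine (hnear.add hfar).mono' (Measurable.aestronglyMeasurable (by fun_prop))
    (Eventually.of_forall fun y => ?_)
  rw [norm_of_nonneg (by positivity), Pi.add_apply]
  by_cases hy : y ∈ closedBall (0 : EuclideanSpace ℝ (Fin n)) 1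
  · rw [indicator_of_mem hy]
    have h1 : (1 + ‖y‖) ^ (1 - n : ℝ) ≤ 1 :=
      rpow_le_one_of_one_le_of_nonpos (by linarith [norm_nonneg y]) (by linarith)
    have h2 : 0 ≤ ‖y‖ ^ b := by positivity
    have h3 : 0 ≤ (2 : ℝ) ^ (-b) * (1 + ‖y‖) ^ (-(n - 1 - b)) := by positivity
    nlinarith
  · rw [indicator_of_notMem hy, zero_add]
    have hy1 : 1 < ‖y‖ := by simpa using hy
    have h1 : ‖y‖ ^ b ≤ ((1 + ‖y‖) / 2) ^ b :=
      rpow_le_rpow_of_nonpos (by positivity) (by linarith) (by linarith)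
    have h2 : (-(n - 1 - b) : ℝ) = (1 - n) + b := by ring
    rw [div_rpow (by positivity) (by norm_num), div_eq_mul_inv, ← rpow_neg (by norm_num)] at h1
    rw [h2, rpow_add (by positivity)]
    calc (1 + ‖y‖) ^ (1 - n : ℝ) * ‖y‖ ^ b
        ≤ (1 + ‖y‖) ^ (1 - n : ℝ) * ((1 + ‖y‖) ^ b * 2 ^ (-b)) := by gcongr
      _ = _ := by ring

theorem SmoothHom.integrable_one_add_norm_rpow_mul (hn : 2 ≤ n) (hb : -2 < b) (hb' : b < -1)
    {f : EuclideanSpace ℝ (Fin n) → ℝ} (hf : SmoothHom b f) :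
    Integrable fun y => (1 + ‖y‖) ^ (1 - n : ℝ) * f y := by
  obtain ⟨C, -, hC⟩ := hf.exists_norm_le
  refine ((integrable_one_add_norm_rpow_mul_norm_rpow hn hb hb').const_mul C).mono'
    (Measurable.aestronglyMeasurable (Measurable.mul (by fun_prop) hf.measurable)) ?_
  filter_upwards [ae_ne_zero hn] with y hy
  rw [norm_mul, norm_of_nonneg (by positivity), mul_left_comm]
  gcongr
  exact hC y hy

theorem SmoothHom.aestronglyMeasurable {V : Type*} [NormedAddCommGroup V] [NormedSpace ℝ V]
    (hn : 2 ≤ n) {k : EuclideanSpace ℝ (Fin n) → V} (hk : SmoothHom b k) :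
    AEStronglyMeasurable k volume := by
  have h := hk.continuousOn.aestronglyMeasurable (μ := volume) (measurableSet_singleton _).compl
  rwa [Measure.restrict_eq_self_of_ae_mem (s := {0}ᶜ) (ae_ne_zero hn)] at h

/-- A kernel of degree at most `1 - n` decays like `(1 + ‖y‖) ^ (1 - n)`, uniformly away from its
pole. -/
theorem SmoothHom.exists_norm_comp_sub_le {V : Type*} [NormedAddCommGroup V] [NormedSpace ℝ V]
    (hn : 2 ≤ n) {k : EuclideanSpace ℝ (Fin n) → V} (hk : SmoothHom b k) (hb : b ≤ 1 - n)
    {δ : ℝ} (hδ : 0 < δ) (R : ℝ) :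
    ∃ C, 0 ≤ C ∧ ∀ x y, ‖x‖ ≤ R → δ ≤ ‖x - y‖ → ‖k (x - y)‖ ≤ C * (1 + ‖y‖) ^ (1 - n : ℝ) := by
  have hn' : (2 : ℝ) ≤ n := by exact_mod_cast hn
  obtain ⟨C, hC0, hC⟩ := hk.exists_norm_le
  have hM : 0 < (1 + |R|) / δ + 1 := by positivity
  refine ⟨C * (δ ^ (b - (1 - n)) * (((1 + |R|) / δ + 1)⁻¹) ^ (1 - n : ℝ)), by positivity,
    fun x y hx hxy => ?_⟩
  have hpos : 0 < ‖x - y‖ := hδ.trans_le hxy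
  refine (hC _ (norm_pos_iff.1 hpos)).trans ?_
  rw [mul_assoc]
  refine mul_le_mul_of_nonneg_left ?_ hC0
  have h1 : 1 + ‖y‖ ≤ ((1 + |R|) / δ + 1) * ‖x - y‖ := by
    have h2 : ‖y‖ ≤ ‖x‖ + ‖x - y‖ := by
      have := norm_sub_le x (x - y)
      rwa [sub_sub_cancel] at this
    have h3 : 1 + |R| ≤ (1 + |R|) / δ * ‖x - y‖ := by
      rw [div_mul_eq_mul_div, le_div_iff₀ hδ]
      gcongr
    linarith [le_abs_self R]
  have h4 : ((1 + |R|) / δ + 1)⁻¹ * (1 + ‖y‖) ≤ ‖x - y‖ := by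
    rwa [inv_mul_le_iff₀ hM]
  calc ‖x - y‖ ^ b = ‖x - y‖ ^ (b - (1 - n)) * ‖x - y‖ ^ (1 - n : ℝ) := by
        rw [← rpow_add hpos]; congr 1; ring
    _ ≤ δ ^ (b - (1 - n)) * (((1 + |R|) / δ + 1)⁻¹ * (1 + ‖y‖)) ^ (1 - n : ℝ) := by
        refine mul_le_mul (rpow_le_rpow_of_nonpos hδ hxy (by linarith))
          (rpow_le_rpow_of_nonpos (by positivity) h4 (by linarith)) (by positivity)
          (by positivity)
    _ = _ := by rw [mul_rpow (by positivity) (by positivity)]; ring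

section Far

variable {V : Type} [NormedAddCommGroup V] [NormedSpace ℝ V] {h : EuclideanSpace ℝ (Fin n) → ℝ}
  {x₀ : EuclideanSpace ℝ (Fin n)} {ρ : ℝ}

theorem norm_sub_ge_of_mem_ball {x y : EuclideanSpace ℝ (Fin n)} (hx : x ∈ ball x₀ (ρ / 2))
    (hy : y ∉ ball x₀ ρ) : ρ / 2 ≤ ‖x - y‖ := by
  rw [mem_ball] at hx hy
  have := dist_triangle_left y x₀ x
  rw [← dist_eq_norm]
  linarith

/-- Integrability of the potential of a density vanishing near the evaluation point. -/
theorem SmoothHom.exists_integrable_bound (hn : 2 ≤ n)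
    (hint : Integrable fun y => (1 + ‖y‖) ^ (1 - n : ℝ) * h y)
    (h0 : ∀ y ∈ ball x₀ ρ, h y = 0) (hρ : 0 < ρ) {k : EuclideanSpace ℝ (Fin n) → V}
    (hk : SmoothHom b k) (hb : b ≤ 1 - n) :
    ∃ g : EuclideanSpace ℝ (Fin n) → ℝ, Integrable g ∧
      ∀ y, ∀ x ∈ ball x₀ (ρ / 2), ‖h y • k (x - y)‖ ≤ g y := by
  obtain ⟨C, hC0, hC⟩ := hk.exists_norm_comp_sub_le hn hb (half_pos hρ) (‖x₀‖ + ρ / 2)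
  refine ⟨fun y => C * ‖(1 + ‖y‖) ^ (1 - n : ℝ) * h y‖, hint.norm.const_mul C,
    fun y x hx => ?_⟩
  by_cases hy : y ∈ ball x₀ ρ
  · simp [h0 y hy]
  · have hxR : ‖x‖ ≤ ‖x₀‖ + ρ / 2 := by
      have h1 := norm_sub_norm_le x x₀
      rw [mem_ball, dist_eq_norm] at hx
      linarith
    beta_reduce
    rw [norm_smul, norm_mul, norm_of_nonneg (r := (1 + ‖y‖) ^ (1 - n : ℝ)) (by positivity)]
    calc ‖h y‖ * ‖k (x - y)‖ ≤ ‖h y‖ * (C * (1 + ‖y‖) ^ (1 - n : ℝ)) := by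
          gcongr
          exact hC x y hxR (norm_sub_ge_of_mem_ball hx hy)
      _ = _ := by ring

theorem SmoothHom.aestronglyMeasurable_smul_comp_sub (hn : 2 ≤ n)
    (hmeas : AEStronglyMeasurable h volume) {k : EuclideanSpace ℝ (Fin n) → V}
    (hk : SmoothHom b k) (x : EuclideanSpace ℝ (Fin n)) :
    AEStronglyMeasurable (fun y => h y • k (x - y)) volume :=
  hmeas.smul ((hk.aestronglyMeasurable hn).comp_measurePreserving
    (Measure.measurePreserving_sub_left volume x))

theorem SmoothHom.hasFDerivAt_integral_far (hn : 2 ≤ n)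
    (hmeas : AEStronglyMeasurable h volume)
    (hint : Integrable fun y => (1 + ‖y‖) ^ (1 - n : ℝ) * h y)
    (h0 : ∀ y ∈ ball x₀ ρ, h y = 0) (hρ : 0 < ρ) {k : EuclideanSpace ℝ (Fin n) → V}
    (hk : SmoothHom b k) (hb : b ≤ 1 - n) {x : EuclideanSpace ℝ (Fin n)}
    (hx : x ∈ ball x₀ (ρ / 2)) :
    HasFDerivAt (fun x => ∫ y, h y • k (x - y)) (∫ y, h y • fderiv ℝ k (x - y)) x := by
  obtain ⟨g, hg, hgb⟩ := hk.exists_integrable_bound hn hint h0 hρ hb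
  obtain ⟨g', hg', hgb'⟩ := hk.fderiv.exists_integrable_bound hn hint h0 hρ (by linarith)
  refine hasFDerivAt_integral_of_dominated_of_fderiv_le (isOpen_ball.mem_nhds hx)
    (Eventually.of_forall fun z => hk.aestronglyMeasurable_smul_comp_sub hn hmeas z)
    (hg.mono' (hk.aestronglyMeasurable_smul_comp_sub hn hmeas x)
      (Eventually.of_forall fun y => hgb y x hx))
    (hk.fderiv.aestronglyMeasurable_smul_comp_sub hn hmeas x)
    (Eventually.of_forall hgb') hg' (Eventually.of_forall fun y z hz => ?_)
  by_cases hy : y ∈ ball x₀ ρ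
  · simpa [h0 y hy] using hasFDerivAt_const (0 : V) z
  · have hzy : z - y ≠ 0 :=
      norm_pos_iff.1 ((half_pos hρ).trans_le (norm_sub_ge_of_mem_ball hz hy))
    exact ((hasFDerivAt_comp_sub y).2 (hk.differentiableAt hzy).hasFDerivAt).const_smul (h y)

end Far

theorem SmoothHom.contDiffOn_integral_far (hn : 2 ≤ n) {h : EuclideanSpace ℝ (Fin n) → ℝ}
    {x₀ : EuclideanSpace ℝ (Fin n)} {ρ : ℝ} (hmeas : AEStronglyMeasurable h volume)
    (hint : Integrable fun y => (1 + ‖y‖) ^ (1 - n : ℝ) * h y)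
    (h0 : ∀ y ∈ ball x₀ ρ, h y = 0) (hρ : 0 < ρ) (m : ℕ) :
    ∀ {V : Type} [NormedAddCommGroup V] [NormedSpace ℝ V] {b : ℝ}
      {k : EuclideanSpace ℝ (Fin n) → V}, SmoothHom b k → b ≤ 1 - n →
      ContDiffOn ℝ m (fun x => ∫ y, h y • k (x - y)) (ball x₀ (ρ / 2)) := by
  induction m with
  | zero =>
    intro V _ _ b k hk hb
    refine contDiffOn_zero.2 fun x hx => ?_
    exact (hk.hasFDerivAt_integral_far hn hmeas hint h0 hρ hb hx).continuousAt.continuousWithinAt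
  | succ m ih =>
    intro V _ _ b k hk hb
    have hd := fun x hx => hk.hasFDerivAt_integral_far hn hmeas hint h0 hρ hb (x := x) hx
    push_cast
    rw [contDiffOn_succ_iff_fderiv_of_isOpen isOpen_ball]
    refine ⟨fun x hx => (hd x hx).differentiableAt.differentiableWithinAt, by simp, ?_⟩
    exact (ih hk.fderiv (by linarith)).congr fun x hx => (hd x hx).fderiv

/-- The `i`-th component of the gradient of the Newtonian potential of `f`, up to
normalization. -/
noncomputable def newtonPot (f : EuclideanSpace ℝ (Fin n) → ℝ) (i : Fin n)
    (x : EuclideanSpace ℝ (Fin n)) : ℝ :=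
  ∫ y, f y * newtonKer i (x - y)

theorem contDiffAt_newtonPot (hn : 2 ≤ n) (hb : -2 < b) (hb' : b < -1)
    {f : EuclideanSpace ℝ (Fin n) → ℝ} (hf : SmoothHom b f) (i : Fin n)
    {x₀ : EuclideanSpace ℝ (Fin n)} (hx₀ : x₀ ≠ 0) : ContDiffAt ℝ ∞ (newtonPot f i) x₀ := by
  have hpos : 0 < ‖x₀‖ := norm_pos_iff.2 hx₀
  let η : ContDiffBump x₀ := ⟨‖x₀‖ / 4, ‖x₀‖ / 2, by positivity, by linarith⟩
  have hη0 : (0 : EuclideanSpace ℝ (Fin n)) ∉ tsupport η := by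
    rw [η.tsupport_eq, mem_closedBall, dist_zero_left, not_le]
    exact half_lt_self hpos
  have hnear : ContDiff ℝ ∞ fun x => η x * f x := hf.contDiff_mul η.contDiff hη0
  have hnearc : HasCompactSupport fun x => η x * f x := η.hasCompactSupport.mul_right
  have hK := smoothHom_newtonKer i
  have hKloc := locallyIntegrable_newtonKer hn i
  let L := ContinuousLinearMap.mul ℝ ℝ
  have hconv : ContDiff ℝ ∞ (convolution (newtonKer i) (fun x => η x * f x) L volume) :=
    hnearc.contDiff_convolution_right L hKloc hnear
  have hconv_int : ∀ x, Integrable fun y => η y * f y * newtonKer i (x - y) := fun x => by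
    have := (hnearc.convolutionExists_right L hKloc hnear.continuous x).integrable_swap
    simpa [L, mul_comm] using this
  have hconv_eq : ∀ x, convolution (newtonKer i) (fun x => η x * f x) L volume x =
      ∫ y, η y * f y * newtonKer i (x - y) := fun x => by
    rw [convolution_eq_swap]
    simp [L, mul_comm]
  let h : EuclideanSpace ℝ (Fin n) → ℝ := fun y => (1 - η y) * f y
  have hmeas : AEStronglyMeasurable h volume :=
    ((measurable_const.sub η.continuous.measurable).mul hf.measurable).aestronglyMeasurable
  have hint : Integrable fun y => (1 + ‖y‖) ^ (1 - n : ℝ) * h y := by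
    refine (hf.integrable_one_add_norm_rpow_mul hn hb hb').mono
      (AEStronglyMeasurable.mul (Measurable.aestronglyMeasurable (by fun_prop)) hmeas)
      (Eventually.of_forall fun y => ?_)
    simp only [h, norm_mul]
    have h1 : ‖1 - η y‖ ≤ 1 := by
      rw [norm_of_nonneg (by linarith [η.le_one (x := y)])]
      linarith [η.nonneg (x := y)]
    gcongr
    exact mul_le_of_le_one_left (norm_nonneg _) h1
  have h0 : ∀ y ∈ ball x₀ η.rIn, h y = 0 := fun y hy => by
    simp [h, η.one_of_mem_closedBall (ball_subset_closedBall hy)]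
  have hfar : ContDiffAt ℝ ∞ (fun x => ∫ y, h y • newtonKer i (x - y)) x₀ :=
    ((contDiffOn_infty.2 fun m =>
      SmoothHom.contDiffOn_integral_far hn hmeas hint h0 η.rIn_pos m hK le_rfl)).contDiffAt
      (ball_mem_nhds _ (half_pos η.rIn_pos))
  refine (hconv.contDiffAt.add hfar).congr_of_eventuallyEq ?_
  obtain ⟨g, hg, hgb⟩ := hK.exists_integrable_bound hn hint h0 η.rIn_pos le_rfl
  filter_upwards [ball_mem_nhds x₀ (half_pos η.rIn_pos)] with x hx
  have hfar_int : Integrable fun y => h y • newtonKer i (x - y) :=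
    hg.mono' (hK.aestronglyMeasurable_smul_comp_sub hn hmeas x)
      (Eventually.of_forall fun y => hgb y x hx)
  rw [hconv_eq, ← integral_add (hconv_int x) hfar_int, newtonPot]
  congr 1 with y
  simp only [h, smul_eq_mul]
  ring

theorem smoothHom_newtonPot (hn : 2 ≤ n) (hb : -2 < b) (hb' : b < -1)
    {f : EuclideanSpace ℝ (Fin n) → ℝ} (hf : SmoothHom b f) (i : Fin n) :
    SmoothHom (b + 1) (newtonPot f i) where
  smooth x hx := (contDiffAt_newtonPot hn hb hb' hf i hx).contDiffWithinAt
  hom t ht x _ := by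
    have h1 := Measure.integral_comp_smul volume (fun y => f y * newtonKer i (t • x - y)) t
    have hK : ∀ z, newtonKer i (t • z) = t ^ (1 - n : ℝ) * newtonKer i z := fun z => by
      by_cases hz : z = 0
      · simp [hz, newtonKer]
      · exact (smoothHom_newtonKer i).hom t ht z hz
    have h2 : ∫ y, f (t • y) * newtonKer i (t • x - t • y) =
        ∫ y, t ^ (b + (1 - n : ℝ)) * (f y * newtonKer i (x - y)) := by
      refine integral_congr_ae ?_
      filter_upwards [ae_ne_zero hn] with y hy
      rw [← smul_sub, hK, hf.hom t ht y hy, rpow_add ht, smul_eq_mul]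
      ring
    rw [h2, integral_const_mul, finrank_euclideanSpace_fin, abs_of_pos (by positivity),
      smul_eq_mul, ← rpow_natCast, ← rpow_neg ht.le] at h1
    change newtonPot f i (t • x) = t ^ (b + 1) * newtonPot f i x
    have h3 : t ^ (b + (1 - n : ℝ)) * newtonPot f i x = t ^ (-n : ℝ) * newtonPot f i (t • x) := h1
    rw [show b + (1 - n : ℝ) = -n + (b + 1) by ring, rpow_add ht, mul_assoc] at h3
    exact (mul_left_cancel₀ (by positivity) h3).symm

/-- Absolute integrability behind Fubini's theorem for potentials. -/
theorem integrable_newtonKer_prod (hn : 2 ≤ n) (hb : -2 < b) (hb' : b < -1)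
    {f : EuclideanSpace ℝ (Fin n) → ℝ} (hf : SmoothHom b f) (i : Fin n)
    {g : EuclideanSpace ℝ (Fin n) → ℝ} (hg : Continuous g) (hc : HasCompactSupport g) :
    Integrable (fun p : EuclideanSpace ℝ (Fin n) × EuclideanSpace ℝ (Fin n) =>
      f p.2 * newtonKer i (p.1 - p.2) * g p.1) (volume.prod volume) := by
  have hn' : (2 : ℝ) ≤ n := by exact_mod_cast hn
  have hK := smoothHom_newtonKer i
  obtain ⟨R, hR0, hR⟩ := hc.isCompact.isBounded.exists_pos_norm_le
  obtain ⟨C, hC0, hC⟩ := hK.exists_norm_comp_sub_le hn le_rfl one_pos R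
  obtain ⟨B, hB⟩ := hc.exists_bound_of_continuous hg
  have hB0 : 0 ≤ B := (norm_nonneg _).trans (hB 0)
  let κ : EuclideanSpace ℝ (Fin n) → ℝ := indicator (closedBall 0 1) fun z => ‖newtonKer i z‖
  have hκ : Integrable κ :=
    IntegrableOn.integrable_indicator ((locallyIntegrable_newtonKer hn i).integrableOn_isCompact
      (isCompact_closedBall _ _)).norm measurableSet_closedBall
  have hκ0 : ∀ z, 0 ≤ κ z := fun z => indicator_nonneg (fun _ _ => norm_nonneg _) z
  let F : EuclideanSpace ℝ (Fin n) → ℝ := fun y => ‖(1 + ‖y‖) ^ (1 - n : ℝ) * f y‖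
  have hF : Integrable F := (hf.integrable_one_add_norm_rpow_mul hn hb hb').norm
  let M : ℝ := (2 + R) ^ (n - 1 : ℝ) * B
  have hH1 : Integrable (fun p : EuclideanSpace ℝ (Fin n) × EuclideanSpace ℝ (Fin n) =>
      C * (‖g p.1‖ * F p.2)) (volume.prod volume) :=
    (((hg.integrable_of_hasCompactSupport hc).norm).mul_prod hF).const_mul C
  have hH2 : Integrable (fun p : EuclideanSpace ℝ (Fin n) × EuclideanSpace ℝ (Fin n) =>
      M * (F p.2 * κ (p.1 - p.2))) (volume.prod volume) :=
    (hF.convolution_integrand (ContinuousLinearMap.mul ℝ ℝ) hκ).const_mul M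
  refine (hH1.add hH2).mono' (Measurable.aestronglyMeasurable
    (((hf.measurable.comp measurable_snd).mul
      (hK.measurable.comp (measurable_fst.sub measurable_snd))).mul
      (hg.measurable.comp measurable_fst))) (Eventually.of_forall fun ⟨x, y⟩ => ?_)
  have hFy : F y = (1 + ‖y‖) ^ (1 - n : ℝ) * ‖f y‖ := by
    simp only [F]
    rw [norm_mul, norm_of_nonneg (by positivity)]
  have hF0 : 0 ≤ F y := norm_nonneg _
  have hM0 : 0 ≤ M := by positivity
  simp only [Pi.add_apply, norm_mul]
  by_cases hx : x ∈ tsupport g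
  swap
  · rw [image_eq_zero_of_notMem_tsupport hx, norm_zero, mul_zero, zero_mul, mul_zero, zero_add]
    exact mul_nonneg hM0 (mul_nonneg hF0 (hκ0 _))
  rcases le_total 1 ‖x - y‖ with hxy | hxy
  · have h1 := hC x y (hR x hx) hxy
    calc ‖f y‖ * ‖newtonKer i (x - y)‖ * ‖g x‖
        ≤ ‖f y‖ * (C * (1 + ‖y‖) ^ (1 - n : ℝ)) * ‖g x‖ := by gcongr
      _ = C * (‖g x‖ * F y) := by rw [hFy]; ring
      _ ≤ _ := le_add_of_nonneg_right (mul_nonneg hM0 (mul_nonneg hF0 (hκ0 _)))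
  · have hκx : κ (x - y) = ‖newtonKer i (x - y)‖ := indicator_of_mem (by simpa using hxy) _
    have hy : 1 + ‖y‖ ≤ 2 + R := by
      have h2 := norm_sub_le x (x - y)
      rw [sub_sub_cancel] at h2
      linarith [hR x hx]
    have h1 : 1 ≤ (2 + R) ^ (n - 1 : ℝ) * (1 + ‖y‖) ^ (1 - n : ℝ) := by
      rw [show (1 - n : ℝ) = -(n - 1) by ring, rpow_neg (by positivity), ← div_eq_mul_inv,
        one_le_div (by positivity)]
      exact rpow_le_rpow (by positivity) hy (by linarith)
    calc ‖f y‖ * ‖newtonKer i (x - y)‖ * ‖g x‖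
        ≤ ‖f y‖ * ‖newtonKer i (x - y)‖ * B := by gcongr; exact hB x
      _ ≤ (2 + R) ^ (n - 1 : ℝ) * (1 + ‖y‖) ^ (1 - n : ℝ) *
          (‖f y‖ * ‖newtonKer i (x - y)‖ * B) := le_mul_of_one_le_left (by positivity) h1
      _ = M * (F y * κ (x - y)) := by rw [hFy, hκx]; ring
      _ ≤ _ := le_add_of_nonneg_left (mul_nonneg hC0 (mul_nonneg (norm_nonneg _) hF0))

theorem integral_newtonKer_comp_sub_mul (i : Fin n) (g : EuclideanSpace ℝ (Fin n) → ℝ)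
    (y : EuclideanSpace ℝ (Fin n)) :
    ∫ x, newtonKer i (x - y) * g x = ∫ z, newtonKer i z * g (z + y) := by
  rw [← integral_sub_right_eq_self (fun z => newtonKer i z * g (z + y)) y]
  simp

theorem integral_newtonPot_mul (hn : 2 ≤ n) (hb : -2 < b) (hb' : b < -1)
    {f : EuclideanSpace ℝ (Fin n) → ℝ} (hf : SmoothHom b f) (i : Fin n)
    {g : EuclideanSpace ℝ (Fin n) → ℝ} (hg : Continuous g) (hc : HasCompactSupport g) :
    Integrable (fun y => f y * ∫ z, newtonKer i z * g (z + y)) ∧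
    ∫ x, newtonPot f i x * g x = ∫ y, f y * ∫ z, newtonKer i z * g (z + y) := by
  have hint := integrable_newtonKer_prod hn hb hb' hf i hg hc
  have hinner : ∀ y, ∫ x, f y * newtonKer i (x - y) * g x =
      f y * ∫ z, newtonKer i z * g (z + y) := fun y => by
    simp only [mul_assoc]
    rw [integral_const_mul, integral_newtonKer_comp_sub_mul]
  refine ⟨by simpa only [hinner] using hint.integral_prod_right, ?_⟩
  simp only [← hinner, newtonPot, ← integral_mul_const]
  exact integral_integral_swap hint

theorem pd_comp_add (i : Fin n) (φ : EuclideanSpace ℝ (Fin n) → ℝ)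
    (y z : EuclideanSpace ℝ (Fin n)) : pd i φ (z + y) = pd i (fun x => φ (x + y)) z := by
  rw [pd, pd, fderiv_comp_add_right]

theorem eq_zero_of_integral_mul_eq_zero {u : EuclideanSpace ℝ (Fin n) → ℝ}
    (hu : ContinuousOn u {0}ᶜ)
    (h : ∀ g : EuclideanSpace ℝ (Fin n) → ℝ, ContDiff ℝ ∞ g → HasCompactSupport g →
      (0 : EuclideanSpace ℝ (Fin n)) ∉ tsupport g → ∫ x, u x * g x = 0) :
    ∀ x ≠ 0, u x = 0 := by
  have hae := isOpen_compl_singleton.ae_eq_zero_of_integral_contDiff_smul_eq_zero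
    (hu.locallyIntegrableOn (μ := volume) (measurableSet_singleton _).compl) fun g hg hc hs => by
      simpa only [smul_eq_mul, mul_comm] using h g hg hc fun h0 => hs h0 rfl
  have heq := Measure.eqOn_open_of_ae_eq (μ := volume)
    ((ae_restrict_iff' (measurableSet_singleton _).compl).2 hae)
    isOpen_compl_singleton hu continuousOn_const
  exact fun x hx => heq hx

theorem SmoothHom.integrable_mul {u φ : EuclideanSpace ℝ (Fin n) → ℝ} (hu : SmoothHom a u)
    (hφ : ContDiff ℝ ∞ φ) (hc : HasCompactSupport φ)
    (h0 : (0 : EuclideanSpace ℝ (Fin n)) ∉ tsupport φ) : Integrable fun x => u x * φ x := by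
  simp only [mul_comm (u _)]
  exact (hu.contDiff_mul hφ h0).continuous.integrable_of_hasCompactSupport hc.mul_right

theorem pd_newtonPot_comm (hn : 2 ≤ n) (hb : -2 < b) (hb' : b < -1)
    {f : EuclideanSpace ℝ (Fin n) → ℝ} (hf : SmoothHom b f) (i j : Fin n)
    {x : EuclideanSpace ℝ (Fin n)} (hx : x ≠ 0) :
    pd j (newtonPot f i) x = pd i (newtonPot f j) x := by
  have hW := smoothHom_newtonPot hn hb hb' hf
  refine sub_eq_zero.1 (eq_zero_of_integral_mul_eq_zero
    (u := fun x => pd j (newtonPot f i) x - pd i (newtonPot f j) x)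
    (((hW i).pd j).sub ((hW j).pd i)).continuousOn (fun g hg hc h0 => ?_) x hx)
  simp only [sub_mul]
  rw [integral_sub (((hW i).pd j).integrable_mul hg hc h0) (((hW j).pd i).integrable_mul hg hc h0)]
  have h1 := (hW i).integral_mul_pd hg hc h0 j
  have h2 := (hW j).integral_mul_pd hg hc h0 i
  have h3 : ∫ x, newtonPot f i x * pd j g x = ∫ x, newtonPot f j x * pd i g x := by
    rw [(integral_newtonPot_mul hn hb hb' hf i (hg.pd j).continuous (hc.pd j)).2,
      (integral_newtonPot_mul hn hb hb' hf j (hg.pd i).continuous (hc.pd i)).2]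
    congr 1 with y
    simp only [pd_comp_add]
    rw [integral_newtonKer_mul_pd_comm hn i j (φ := fun x => g (x + y))
      (hg.comp (contDiff_id.add contDiff_const))
      (hc.comp_homeomorph (Homeomorph.addRight y))]
  linarith

theorem exists_sum_pd_newtonPot (hn : 2 ≤ n) : ∃ c : ℝ, 0 < c ∧
    ∀ {b : ℝ}, -2 < b → b < -1 → ∀ {f : EuclideanSpace ℝ (Fin n) → ℝ}, SmoothHom b f →
      ∀ x ≠ 0, ∑ i, pd i (newtonPot f i) x = c * f x := by
  obtain ⟨c, hc0, hcφ⟩ := exists_sum_integral_newtonKer_mul_pd hn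
  refine ⟨c, hc0, fun {b} hb hb' {f} hf x hx => ?_⟩
  have hW := smoothHom_newtonPot hn hb hb' hf
  have hdiv := SmoothHom.sum Finset.univ fun i => (hW i).pd i
  refine sub_eq_zero.1 (eq_zero_of_integral_mul_eq_zero
    (u := fun x => ∑ i, pd i (newtonPot f i) x - c * f x)
    (hdiv.continuousOn.sub (hf.const_mul c).continuousOn) (fun g hg hc h0 => ?_) x hx)
  simp only [sub_mul]
  rw [integral_sub (hdiv.integrable_mul hg hc h0) ((hf.const_mul c).integrable_mul hg hc h0)]
  simp only [Finset.sum_mul, mul_assoc]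
  rw [integral_finsetSum _ fun i _ => ((hW i).pd i).integrable_mul hg hc h0, integral_const_mul]
  have h1 := fun i => integral_newtonPot_mul hn hb hb' hf i (hg.pd i).continuous (hc.pd i)
  have h2 : ∀ i, ∫ x, pd i (newtonPot f i) x * g x =
      -∫ y, f y * ∫ z, newtonKer i z * pd i g (z + y) := fun i => by
    rw [← (h1 i).2, (hW i).integral_mul_pd hg hc h0 i, neg_neg]
  simp only [h2, Finset.sum_neg_distrib]
  rw [← integral_finsetSum _ fun i _ => (h1 i).1, ← integral_const_mul, ← integral_neg,
    sub_eq_zero]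
  congr 1 with y
  have h3 := hcφ _ (hg.comp (contDiff_id.add (contDiff_const (c := y))))
    (hc.comp_homeomorph (Homeomorph.addRight y))
  simp only [pd_comp_add, ← Finset.mul_sum]
  simp only [Function.comp_def, id, zero_add] at h3
  rw [h3]
  ring

theorem lapSurj_of_mem_Ioo (hn : 2 ≤ n) (ha : 0 < a) (ha' : a < 1) : LapSurj n a := by
  intro f hf
  obtain ⟨c, hc0, hc⟩ := exists_sum_pd_newtonPot hn
  have hb : -2 < a - 2 := by linarith
  have hb' : a - 2 < -1 := by linarith
  have hW : ∀ i, SmoothHom (a - 1) (newtonPot f i) := fun i => by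
    have := smoothHom_newtonPot hn hb hb' hf i
    rwa [show a - 2 + 1 = a - 1 by ring] at this
  obtain ⟨u, hu, hpd⟩ := smoothHom_primitive_of_curl_free hW ha.ne'
    fun i j x hx => pd_newtonPot_comm hn hb hb' hf i j hx
  refine ⟨fun x => -c⁻¹ * u x, hu.const_mul _, fun x hx => ?_⟩
  have h1 : ∀ i, pd i (pd i fun x => -c⁻¹ * u x) x = -c⁻¹ * pd i (newtonPot f i) x := fun i => by
    rw [pd_congr (v := fun y => -c⁻¹ * newtonPot f i y) (fun y hy => ?_) hx,
      pd_const_mul _ ((hW i).differentiableAt hx)]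
    rw [pd_const_mul _ (hu.differentiableAt hy), hpd i y hy]
  rw [lap_eq_neg_sum_pd]
  simp only [h1, ← Finset.mul_sum, hc hb hb' hf x hx]
  field_simp

end Potential

theorem iterated_laplacian_bijective_on_nonintegral_homogeneous
    (n k : ℕ) (hn : 2 ≤ n) (hk : 1 ≤ k) (α : ℝ) (hα : ∀ m : ℤ, α ≠ (m : ℝ))
    (f : EuclideanSpace ℝ (Fin n) → ℝ)
    (hf : ContDiffOn ℝ (⊤ : ℕ∞) f {(0 : EuclideanSpace ℝ (Fin n))}ᶜ)
    (hfhom : ∀ t : ℝ, 0 < t → ∀ x : EuclideanSpace ℝ (Fin n), x ≠ 0 →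
      f (t • x) = t ^ (α - 2 * k) * f x) :
    (∃ u : EuclideanSpace ℝ (Fin n) → ℝ,
      ContDiffOn ℝ (⊤ : ℕ∞) u {(0 : EuclideanSpace ℝ (Fin n))}ᶜ ∧
      (∀ t : ℝ, 0 < t → ∀ x : EuclideanSpace ℝ (Fin n), x ≠ 0 →
        u (t • x) = t ^ α * u x) ∧
      (∀ x : EuclideanSpace ℝ (Fin n), x ≠ 0 → lapIter k u x = f x)) ∧
    (∀ u₁ u₂ : EuclideanSpace ℝ (Fin n) → ℝ,
      ContDiffOn ℝ (⊤ : ℕ∞) u₁ {(0 : EuclideanSpace ℝ (Fin n))}ᶜ →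
      (∀ t : ℝ, 0 < t → ∀ x : EuclideanSpace ℝ (Fin n), x ≠ 0 →
        u₁ (t • x) = t ^ α * u₁ x) →
      (∀ x : EuclideanSpace ℝ (Fin n), x ≠ 0 → lapIter k u₁ x = f x) →
      ContDiffOn ℝ (⊤ : ℕ∞) u₂ {(0 : EuclideanSpace ℝ (Fin n))}ᶜ →
      (∀ t : ℝ, 0 < t → ∀ x : EuclideanSpace ℝ (Fin n), x ≠ 0 →
        u₂ (t • x) = t ^ α * u₂ x) →
      (∀ x : EuclideanSpace ℝ (Fin n), x ≠ 0 → lapIter k u₂ x = f x) →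
      ∀ x : EuclideanSpace ℝ (Fin n), x ≠ 0 → u₁ x = u₂ x) := by
  have hsurj01 : ∀ a : ℝ, 0 < a → a < 1 → LapSurj n a := fun a => lapSurj_of_mem_Ioo hn
  have hinj : ∀ a : ℝ, (∀ m : ℤ, a ≠ m) → LapInj n a := fun a ha =>
    LapInj.of_nonintegral (fun b h h' => (hsurj01 b h h').lapInj) ha
  have hsurj : ∀ a : ℝ, (∀ m : ℤ, a ≠ m) → LapSurj n a := fun a ha =>
    LapSurj.of_nonintegral hsurj01 hinj ha
  refine ⟨?_, fun u₁ u₂ h₁ hom₁ hlap₁ h₂ hom₂ hlap₂ => ?_⟩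
  · obtain ⟨u, hu, hlap⟩ := lapIter_surj hsurj k hα ⟨hf, hfhom⟩
    exact ⟨u, hu.smooth, hu.hom, hlap⟩
  · exact lapIter_inj hinj k hα ⟨h₁, hom₁⟩ ⟨h₂, hom₂⟩ fun x hx =>
      (hlap₁ x hx).trans (hlap₂ x hx).symm
end
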